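/- Let A be a right weak bimonoid in a duoidal category (M,∘,I,•,J) in which idempotent morphisms split. Define the left R_∘-coaction ρ := (π^R_∘•A).((τ∘A)•A).Δ : A → R_∘•A and the morphism ρ₂ := (γ_J•(A∘A)).ζ.(A∘ρ) : A∘A → R_∘•(A∘A), where ζ : A∘(R_∘•A) ≅ (J•A)∘(R_∘•A) → (J∘R_∘)•(A∘A). Then ρ₂ is a coassociative counital left R_∘-coaction on A∘A, and the multiplication μ : A∘A → A is a morphism of left R_∘-comodules: ρ.μ = (R_∘•μ).ρ₂. -/

import Mathlib

open CategoryTheory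

universe v u

/-- A (strict) duoidal category structure on a category `M`: two strict monoidal
structures `co` (the first monoidal product `∘` with unit `uI`) and `bu` (the second
monoidal product `•` with unit `uJ`), together with the structure morphisms
`dlI : I ⟶ I • I`, `pw : J ∘ J ⟶ J`, `tau : I ⟶ J` and the interchange law `zt`,
subject to the axioms of a duoidal category. -/
structure Duo (M : Type u) [Category.{v} M] where
  co : M → M → M
  coh : ∀ {X₁ Y₁ X₂ Y₂ : M}, (X₁ ⟶ Y₁) → (X₂ ⟶ Y₂) → (co X₁ X₂ ⟶ co Y₁ Y₂)
  uI : M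
  bu : M → M → M
  buh : ∀ {X₁ Y₁ X₂ Y₂ : M}, (X₁ ⟶ Y₁) → (X₂ ⟶ Y₂) → (bu X₁ X₂ ⟶ bu Y₁ Y₂)
  uJ : M
  coA : ∀ X Y Z, co (co X Y) Z = co X (co Y Z)
  coL : ∀ X, co uI X = X
  coR : ∀ X, co X uI = X
  buA : ∀ X Y Z, bu (bu X Y) Z = bu X (bu Y Z)
  buL : ∀ X, bu uJ X = X
  buR : ∀ X, bu X uJ = X
  coh_id : ∀ X Y, coh (𝟙 X) (𝟙 Y) = 𝟙 (co X Y)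
  coh_comp : ∀ {X₁ Y₁ Z₁ X₂ Y₂ Z₂ : M} (f₁ : X₁ ⟶ Y₁) (g₁ : Y₁ ⟶ Z₁) (f₂ : X₂ ⟶ Y₂)
    (g₂ : Y₂ ⟶ Z₂), coh (f₁ ≫ g₁) (f₂ ≫ g₂) = coh f₁ f₂ ≫ coh g₁ g₂
  buh_id : ∀ X Y, buh (𝟙 X) (𝟙 Y) = 𝟙 (bu X Y)
  buh_comp : ∀ {X₁ Y₁ Z₁ X₂ Y₂ Z₂ : M} (f₁ : X₁ ⟶ Y₁) (g₁ : Y₁ ⟶ Z₁) (f₂ : X₂ ⟶ Y₂)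
    (g₂ : Y₂ ⟶ Z₂), buh (f₁ ≫ g₁) (f₂ ≫ g₂) = buh f₁ f₂ ≫ buh g₁ g₂
  coh_assoc : ∀ {X₁ Y₁ X₂ Y₂ X₃ Y₃ : M} (f₁ : X₁ ⟶ Y₁) (f₂ : X₂ ⟶ Y₂) (f₃ : X₃ ⟶ Y₃),
    coh (coh f₁ f₂) f₃
      = eqToHom (coA X₁ X₂ X₃) ≫ coh f₁ (coh f₂ f₃) ≫ eqToHom (coA Y₁ Y₂ Y₃).symm
  coh_unitL : ∀ {X Y : M} (f : X ⟶ Y),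
    coh (𝟙 uI) f = eqToHom (coL X) ≫ f ≫ eqToHom (coL Y).symm
  coh_unitR : ∀ {X Y : M} (f : X ⟶ Y),
    coh f (𝟙 uI) = eqToHom (coR X) ≫ f ≫ eqToHom (coR Y).symm
  buh_assoc : ∀ {X₁ Y₁ X₂ Y₂ X₃ Y₃ : M} (f₁ : X₁ ⟶ Y₁) (f₂ : X₂ ⟶ Y₂) (f₃ : X₃ ⟶ Y₃),
    buh (buh f₁ f₂) f₃
      = eqToHom (buA X₁ X₂ X₃) ≫ buh f₁ (buh f₂ f₃) ≫ eqToHom (buA Y₁ Y₂ Y₃).symm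
  buh_unitL : ∀ {X Y : M} (f : X ⟶ Y),
    buh (𝟙 uJ) f = eqToHom (buL X) ≫ f ≫ eqToHom (buL Y).symm
  buh_unitR : ∀ {X Y : M} (f : X ⟶ Y),
    buh f (𝟙 uJ) = eqToHom (buR X) ≫ f ≫ eqToHom (buR Y).symm
  dlI : uI ⟶ bu uI uI
  pw : co uJ uJ ⟶ uJ
  tau : uI ⟶ uJ
  zt : ∀ A B C D : M, co (bu A B) (bu C D) ⟶ bu (co A C) (co B D)
  zt_nat : ∀ {A A' B B' C C' D D' : M} (f : A ⟶ A') (g : B ⟶ B') (h : C ⟶ C')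
    (k : D ⟶ D'),
    coh (buh f g) (buh h k) ≫ zt A' B' C' D' = zt A B C D ≫ buh (coh f h) (coh g k)
  pw_assoc : coh pw (𝟙 uJ) ≫ pw = eqToHom (coA uJ uJ uJ) ≫ coh (𝟙 uJ) pw ≫ pw
  pw_unitL : eqToHom (coL uJ).symm ≫ coh tau (𝟙 uJ) ≫ pw = 𝟙 uJ
  pw_unitR : eqToHom (coR uJ).symm ≫ coh (𝟙 uJ) tau ≫ pw = 𝟙 uJ
  dlI_coassoc : dlI ≫ buh dlI (𝟙 uI) ≫ eqToHom (buA uI uI uI) = dlI ≫ buh (𝟙 uI) dlI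
  dlI_counitL : dlI ≫ buh tau (𝟙 uI) ≫ eqToHom (buL uI) = 𝟙 uI
  dlI_counitR : dlI ≫ buh (𝟙 uI) tau ≫ eqToHom (buR uI) = 𝟙 uI
  zt_assoc1 : ∀ A B C D E F : M,
    coh (zt A B C D) (𝟙 (bu E F)) ≫ zt (co A C) (co B D) E F
      = eqToHom (coA (bu A B) (bu C D) (bu E F)) ≫ coh (𝟙 (bu A B)) (zt C D E F)
          ≫ zt A B (co C E) (co D F)
          ≫ eqToHom (show bu (co A (co C E)) (co B (co D F))
              = bu (co (co A C) E) (co (co B D) F) by simp [coA])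
  zt_assoc2 : ∀ A B C D E F : M,
    zt (bu A B) C (bu D E) F ≫ buh (zt A B D E) (𝟙 (co C F))
      = eqToHom (show co (bu (bu A B) C) (bu (bu D E) F)
            = co (bu A (bu B C)) (bu D (bu E F)) by simp [buA])
          ≫ zt A (bu B C) D (bu E F) ≫ buh (𝟙 (co A D)) (zt B C E F)
          ≫ eqToHom (buA (co A D) (co B E) (co C F)).symm
  zt_unitA : ∀ A B : M,
    eqToHom (coL (bu A B)).symm ≫ coh dlI (𝟙 (bu A B)) ≫ zt uI uI A B
      ≫ eqToHom (show bu (co uI A) (co uI B) = bu A B by simp [coL]) = 𝟙 (bu A B)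
  zt_unitB : ∀ A B : M,
    eqToHom (coR (bu A B)).symm ≫ coh (𝟙 (bu A B)) dlI ≫ zt A B uI uI
      ≫ eqToHom (show bu (co A uI) (co B uI) = bu A B by simp [coR]) = 𝟙 (bu A B)
  zt_unitC : ∀ A B : M,
    eqToHom (show co A B = co (bu uJ A) (bu uJ B) by simp [buL]) ≫ zt uJ A uJ B
      ≫ buh pw (𝟙 (co A B)) ≫ eqToHom (buL (co A B)) = 𝟙 (co A B)
  zt_unitD : ∀ A B : M,
    eqToHom (show co A B = co (bu A uJ) (bu B uJ) by simp [buR]) ≫ zt A uJ B uJ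
      ≫ buh (𝟙 (co A B)) pw ≫ eqToHom (buR (co A B)) = 𝟙 (co A B)

namespace Duo

variable {M : Type u} [Category.{v} M] (D : Duo M)

/-- Axiom (WB): the multiplication is comultiplicative. -/
def WBeq (A : M) (mu : D.co A A ⟶ A) (dl : A ⟶ D.bu A A) : Prop :=
  mu ≫ dl = D.coh dl dl ≫ D.zt A A A A ≫ D.buh mu mu

/-- Axiom (RRU). -/
def RRUeq (A : M) (mu : D.co A A ⟶ A) (eta : D.uI ⟶ A) (dl : A ⟶ D.bu A A) : Prop :=
  D.dlI ≫ D.buh (𝟙 D.uI) (eta ≫ dl)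
    ≫ eqToHom (show D.bu D.uI (D.bu A A) = D.bu (D.co (D.bu D.uI A) D.uI) A by
        simp [D.coR, D.buA])
    ≫ D.buh (D.coh (𝟙 (D.bu D.uI A)) D.dlI) (𝟙 A)
    ≫ D.buh (D.coh (𝟙 (D.bu D.uI A)) (D.buh (𝟙 D.uI) (eta ≫ dl))) (𝟙 A)
    ≫ eqToHom (show D.bu (D.co (D.bu D.uI A) (D.bu D.uI (D.bu A A))) A
        = D.bu (D.co (D.bu D.uI A) (D.bu (D.bu D.uI A) A)) A by simp [D.buA])
    ≫ D.buh (D.zt D.uI A (D.bu D.uI A) A) (𝟙 A)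
    ≫ eqToHom (show D.bu (D.bu (D.co D.uI (D.bu D.uI A)) (D.co A A)) A
        = D.bu (D.bu (D.bu D.uI A) (D.co A A)) A by simp [D.coL])
    ≫ D.buh (D.buh (𝟙 (D.bu D.uI A)) mu) (𝟙 A)
  = D.dlI ≫ D.buh (𝟙 D.uI) eta ≫ D.buh (𝟙 D.uI) dl
    ≫ eqToHom (show D.bu D.uI (D.bu A A) = D.bu (D.bu D.uI A) A by simp [D.buA])
    ≫ D.buh (𝟙 (D.bu D.uI A)) dl
    ≫ eqToHom (show D.bu (D.bu D.uI A) (D.bu A A)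
        = D.bu (D.bu (D.bu D.uI A) A) A by simp [D.buA])

/-- Axiom (LRU). -/
def LRUeq (A : M) (mu : D.co A A ⟶ A) (eta : D.uI ⟶ A) (dl : A ⟶ D.bu A A) : Prop :=
  D.dlI ≫ D.buh (eta ≫ dl) (𝟙 D.uI)
    ≫ eqToHom (show D.bu (D.bu A A) D.uI = D.bu A (D.co (D.bu A D.uI) D.uI) by
        simp [D.coR, D.buA])
    ≫ D.buh (𝟙 A) (D.coh (𝟙 (D.bu A D.uI)) D.dlI)
    ≫ D.buh (𝟙 A) (D.coh (𝟙 (D.bu A D.uI)) (D.buh (eta ≫ dl) (𝟙 D.uI)))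
    ≫ eqToHom (show D.bu A (D.co (D.bu A D.uI) (D.bu (D.bu A A) D.uI))
        = D.bu A (D.co (D.bu A D.uI) (D.bu A (D.bu A D.uI))) by simp [D.buA])
    ≫ D.buh (𝟙 A) (D.zt A D.uI A (D.bu A D.uI))
    ≫ eqToHom (show D.bu A (D.bu (D.co A A) (D.co D.uI (D.bu A D.uI)))
        = D.bu (D.bu (D.bu A (D.co A A)) A) D.uI by simp [D.coL, D.buA])
    ≫ D.buh (D.buh (D.buh (𝟙 A) mu) (𝟙 A)) (𝟙 D.uI)
  = D.dlI ≫ D.buh eta (𝟙 D.uI) ≫ D.buh dl (𝟙 D.uI) ≫ D.buh (D.buh dl (𝟙 A)) (𝟙 D.uI)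

/-- Axiom (LRC). -/
def LRCeq (A : M) (mu : D.co A A ⟶ A) (dl : A ⟶ D.bu A A) (ep : A ⟶ D.uJ) : Prop :=
  D.coh (D.coh (𝟙 (D.co D.uJ A)) dl) (𝟙 A)
    ≫ eqToHom (show D.co (D.co (D.co D.uJ A) (D.bu A A)) A
        = D.co (D.co (D.bu (D.co D.uJ A) D.uJ) (D.bu A A)) A by simp [D.buR])
    ≫ D.coh (D.zt (D.co D.uJ A) D.uJ A A) (𝟙 A)
    ≫ D.coh (D.buh (eqToHom (D.coA D.uJ A A) ≫ D.coh (𝟙 D.uJ) (mu ≫ ep))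
        (𝟙 (D.co D.uJ A))) (𝟙 A)
    ≫ D.coh (D.buh D.pw (𝟙 (D.co D.uJ A))) (𝟙 A)
    ≫ eqToHom (show D.co (D.bu D.uJ (D.co D.uJ A)) A = D.co D.uJ (D.co A A) by
        simp [D.buL, D.coA])
    ≫ D.coh (𝟙 D.uJ) (mu ≫ ep) ≫ D.pw
  = eqToHom (show D.co (D.co (D.co D.uJ A) A) A = D.co (D.co D.uJ A) (D.co A A) by
        simp [D.coA])
    ≫ D.coh (𝟙 (D.co D.uJ A)) mu
    ≫ eqToHom (D.coA D.uJ A A)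
    ≫ D.coh (𝟙 D.uJ) mu ≫ D.coh (𝟙 D.uJ) ep ≫ D.pw

/-- Axiom (LLC). -/
def LLCeq (A : M) (mu : D.co A A ⟶ A) (dl : A ⟶ D.bu A A) (ep : A ⟶ D.uJ) : Prop :=
  D.coh (D.coh (𝟙 (D.co D.uJ A)) dl) (𝟙 A)
    ≫ eqToHom (show D.co (D.co (D.co D.uJ A) (D.bu A A)) A
        = D.co (D.co (D.bu D.uJ (D.co D.uJ A)) (D.bu A A)) A by simp [D.buL])
    ≫ D.coh (D.zt D.uJ (D.co D.uJ A) A A) (𝟙 A)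
    ≫ D.coh (D.buh (𝟙 (D.co D.uJ A))
        (eqToHom (D.coA D.uJ A A) ≫ D.coh (𝟙 D.uJ) (mu ≫ ep))) (𝟙 A)
    ≫ D.coh (D.buh (𝟙 (D.co D.uJ A)) D.pw) (𝟙 A)
    ≫ eqToHom (show D.co (D.bu (D.co D.uJ A) D.uJ) A = D.co D.uJ (D.co A A) by
        simp [D.buR, D.coA])
    ≫ D.coh (𝟙 D.uJ) (mu ≫ ep) ≫ D.pw
  = eqToHom (show D.co (D.co (D.co D.uJ A) A) A = D.co (D.co D.uJ A) (D.co A A) by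
        simp [D.coA])
    ≫ D.coh (𝟙 (D.co D.uJ A)) mu
    ≫ eqToHom (D.coA D.uJ A A)
    ≫ D.coh (𝟙 D.uJ) mu ≫ D.coh (𝟙 D.uJ) ep ≫ D.pw

/-- Axiom (RLU), obtained from (RRU) by replacing `∘` by its opposite. -/
def RLUeq (A : M) (mu : D.co A A ⟶ A) (eta : D.uI ⟶ A) (dl : A ⟶ D.bu A A) : Prop :=
  D.dlI ≫ D.buh (𝟙 D.uI) (eta ≫ dl)
    ≫ eqToHom (show D.bu D.uI (D.bu A A) = D.bu (D.co D.uI (D.bu D.uI A)) A by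
        simp [D.coL, D.buA])
    ≫ D.buh (D.coh D.dlI (𝟙 (D.bu D.uI A))) (𝟙 A)
    ≫ D.buh (D.coh (D.buh (𝟙 D.uI) (eta ≫ dl)) (𝟙 (D.bu D.uI A))) (𝟙 A)
    ≫ eqToHom (show D.bu (D.co (D.bu D.uI (D.bu A A)) (D.bu D.uI A)) A
        = D.bu (D.co (D.bu (D.bu D.uI A) A) (D.bu D.uI A)) A by simp [D.buA])
    ≫ D.buh (D.zt (D.bu D.uI A) A D.uI A) (𝟙 A)
    ≫ eqToHom (show D.bu (D.bu (D.co (D.bu D.uI A) D.uI) (D.co A A)) A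
        = D.bu (D.bu (D.bu D.uI A) (D.co A A)) A by simp [D.coR])
    ≫ D.buh (D.buh (𝟙 (D.bu D.uI A)) mu) (𝟙 A)
  = D.dlI ≫ D.buh (𝟙 D.uI) eta ≫ D.buh (𝟙 D.uI) dl
    ≫ eqToHom (show D.bu D.uI (D.bu A A) = D.bu (D.bu D.uI A) A by simp [D.buA])
    ≫ D.buh (𝟙 (D.bu D.uI A)) dl
    ≫ eqToHom (show D.bu (D.bu D.uI A) (D.bu A A)
        = D.bu (D.bu (D.bu D.uI A) A) A by simp [D.buA])

/-- Axiom (LLU), obtained from (LRU) by replacing `∘` by its opposite. -/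
def LLUeq (A : M) (mu : D.co A A ⟶ A) (eta : D.uI ⟶ A) (dl : A ⟶ D.bu A A) : Prop :=
  D.dlI ≫ D.buh (eta ≫ dl) (𝟙 D.uI)
    ≫ eqToHom (show D.bu (D.bu A A) D.uI = D.bu A (D.co D.uI (D.bu A D.uI)) by
        simp [D.coL, D.buA])
    ≫ D.buh (𝟙 A) (D.coh D.dlI (𝟙 (D.bu A D.uI)))
    ≫ D.buh (𝟙 A) (D.coh (D.buh (eta ≫ dl) (𝟙 D.uI)) (𝟙 (D.bu A D.uI)))
    ≫ eqToHom (show D.bu A (D.co (D.bu (D.bu A A) D.uI) (D.bu A D.uI))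
        = D.bu A (D.co (D.bu A (D.bu A D.uI)) (D.bu A D.uI)) by simp [D.buA])
    ≫ D.buh (𝟙 A) (D.zt A (D.bu A D.uI) A D.uI)
    ≫ eqToHom (show D.bu A (D.bu (D.co A A) (D.co (D.bu A D.uI) D.uI))
        = D.bu (D.bu (D.bu A (D.co A A)) A) D.uI by simp [D.coR, D.buA])
    ≫ D.buh (D.buh (D.buh (𝟙 A) mu) (𝟙 A)) (𝟙 D.uI)
  = D.dlI ≫ D.buh eta (𝟙 D.uI) ≫ D.buh dl (𝟙 D.uI) ≫ D.buh (D.buh dl (𝟙 A)) (𝟙 D.uI)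

/-- Axiom (RRC), obtained from (LLC) by replacing `∘` by its opposite. -/
def RRCeq (A : M) (mu : D.co A A ⟶ A) (dl : A ⟶ D.bu A A) (ep : A ⟶ D.uJ) : Prop :=
  D.coh (D.coh (D.coh (𝟙 A) dl) (𝟙 A)) (𝟙 D.uJ)
    ≫ eqToHom (show D.co (D.co (D.co A (D.bu A A)) A) D.uJ
        = D.co A (D.co (D.bu A A) (D.bu (D.co A D.uJ) D.uJ)) by simp [D.coA, D.buR])
    ≫ D.coh (𝟙 A) (D.zt A A (D.co A D.uJ) D.uJ)
    ≫ D.coh (𝟙 A) (D.buh (eqToHom (D.coA A A D.uJ).symm ≫ D.coh (mu ≫ ep) (𝟙 D.uJ))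
        (𝟙 (D.co A D.uJ)))
    ≫ D.coh (𝟙 A) (D.buh D.pw (𝟙 (D.co A D.uJ)))
    ≫ eqToHom (show D.co A (D.bu D.uJ (D.co A D.uJ)) = D.co (D.co A A) D.uJ by
        simp [D.buL, D.coA])
    ≫ D.coh (mu ≫ ep) (𝟙 D.uJ) ≫ D.pw
  = D.coh (D.coh mu (𝟙 A)) (𝟙 D.uJ) ≫ D.coh mu (𝟙 D.uJ) ≫ D.coh ep (𝟙 D.uJ) ≫ D.pw

/-- Axiom (RLC), obtained from (LRC) by replacing `∘` by its opposite. -/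
def RLCeq (A : M) (mu : D.co A A ⟶ A) (dl : A ⟶ D.bu A A) (ep : A ⟶ D.uJ) : Prop :=
  D.coh (D.coh (D.coh (𝟙 A) dl) (𝟙 A)) (𝟙 D.uJ)
    ≫ eqToHom (show D.co (D.co (D.co A (D.bu A A)) A) D.uJ
        = D.co A (D.co (D.bu A A) (D.bu D.uJ (D.co A D.uJ))) by simp [D.coA, D.buL])
    ≫ D.coh (𝟙 A) (D.zt A A D.uJ (D.co A D.uJ))
    ≫ D.coh (𝟙 A) (D.buh (𝟙 (D.co A D.uJ))
        (eqToHom (D.coA A A D.uJ).symm ≫ D.coh (mu ≫ ep) (𝟙 D.uJ)))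
    ≫ D.coh (𝟙 A) (D.buh (𝟙 (D.co A D.uJ)) D.pw)
    ≫ eqToHom (show D.co A (D.bu (D.co A D.uJ) D.uJ) = D.co (D.co A A) D.uJ by
        simp [D.buR, D.coA])
    ≫ D.coh (mu ≫ ep) (𝟙 D.uJ) ≫ D.pw
  = D.coh (D.coh mu (𝟙 A)) (𝟙 D.uJ) ≫ D.coh mu (𝟙 D.uJ) ≫ D.coh ep (𝟙 D.uJ) ≫ D.pw

end Duo

/-- A right weak bimonoid in a duoidal category. -/
structure RWB {M : Type u} [Category.{v} M] (D : Duo M) where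
  A : M
  mu : D.co A A ⟶ A
  eta : D.uI ⟶ A
  dl : A ⟶ D.bu A A
  ep : A ⟶ D.uJ
  mu_assoc : D.coh mu (𝟙 A) ≫ mu = eqToHom (D.coA A A A) ≫ D.coh (𝟙 A) mu ≫ mu
  mu_unitL : eqToHom (D.coL A).symm ≫ D.coh eta (𝟙 A) ≫ mu = 𝟙 A
  mu_unitR : eqToHom (D.coR A).symm ≫ D.coh (𝟙 A) eta ≫ mu = 𝟙 A
  dl_coassoc : dl ≫ D.buh dl (𝟙 A) ≫ eqToHom (D.buA A A A) = dl ≫ D.buh (𝟙 A) dl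
  dl_counitL : dl ≫ D.buh ep (𝟙 A) ≫ eqToHom (D.buL A) = 𝟙 A
  dl_counitR : dl ≫ D.buh (𝟙 A) ep ≫ eqToHom (D.buR A) = 𝟙 A
  wb : D.WBeq A mu dl
  rru : D.RRUeq A mu eta dl
  lru : D.LRUeq A mu eta dl
  lrc : D.LRCeq A mu dl ep
  llc : D.LLCeq A mu dl ep

/-- A weak bimonoid: both a right weak bimonoid and a left weak bimonoid. -/
structure WBim {M : Type u} [Category.{v} M] (D : Duo M) extends RWB D where
  rlu : D.RLUeq A mu eta dl
  llu : D.LLUeq A mu eta dl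
  rlc : D.RLCeq A mu dl ep
  rrc : D.RRCeq A mu dl ep

/-- Idempotent morphisms split in `M`. -/
def SplitIdem (M : Type u) [Category.{v} M] : Prop :=
  ∀ ⦃X : M⦄ (e : X ⟶ X), e ≫ e = e →
    ∃ (Y : M) (p : X ⟶ Y) (i : Y ⟶ X), p ≫ i = e ∧ i ≫ p = 𝟙 Y

namespace RWB

variable {M : Type u} [Category.{v} M] {D : Duo M} (W : RWB D)

/-- The object `J∘A`. -/
def JA : M := D.co D.uJ W.A

/-- The idempotent morphism `⊓^R_∘ :=
((J∘A)•ϖ).((J∘A)•(J∘(ε.μ))).ζ.(J∘A∘(Δ.η)) : J∘A ⟶ J∘A`. -/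
def sqcapR : W.JA ⟶ W.JA :=
  eqToHom (show W.JA = D.co W.JA D.uI by simp [D.coR])
    ≫ D.coh (𝟙 W.JA) (W.eta ≫ W.dl)
    ≫ eqToHom (show D.co W.JA (D.bu W.A W.A)
        = D.co (D.bu D.uJ W.JA) (D.bu W.A W.A) by simp [D.buL])
    ≫ D.zt D.uJ W.JA W.A W.A
    ≫ D.buh (𝟙 W.JA) (eqToHom (D.coA D.uJ W.A W.A) ≫ D.coh (𝟙 D.uJ) (W.mu ≫ W.ep))
    ≫ D.buh (𝟙 W.JA) D.pw
    ≫ eqToHom (D.buR W.JA)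

/-- The natural idempotent `χ^R_{F,G} = (φ•γ).ζ.((F•G)∘(Δ.η))` on `F•G`, for right
`A`-modules `(F,f)` and `(G,g)`. -/
def chiR (F G : M) (f : D.co F W.A ⟶ F) (g : D.co G W.A ⟶ G) :
    D.bu F G ⟶ D.bu F G :=
  eqToHom (show D.bu F G = D.co (D.bu F G) D.uI by simp [D.coR])
    ≫ D.coh (𝟙 (D.bu F G)) (W.eta ≫ W.dl)
    ≫ D.zt F G W.A W.A
    ≫ D.buh f g

/-- The morphism `J∘η : J ⟶ J∘A`. -/
def jeta : D.uJ ⟶ W.JA :=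
  eqToHom (D.coR D.uJ).symm ≫ D.coh (𝟙 D.uJ) W.eta

/-- The morphism `(π^R_∘).(τ∘A) : A ⟶ R_∘` needs `τ∘A : A ⟶ J∘A`. -/
def tauA : W.A ⟶ W.JA :=
  eqToHom (D.coL W.A).symm ≫ D.coh D.tau (𝟙 W.A)

section Retract

variable (R : M) (p : W.JA ⟶ R) (i : R ⟶ W.JA)

/-- The right `A`-action `γ_A = π^R_∘.(J∘μ).(ι^R_∘ ∘ A)` on the retract `R_∘`. -/
def gamA : D.co R W.A ⟶ R :=
  D.coh i (𝟙 W.A) ≫ eqToHom (D.coA D.uJ W.A W.A) ≫ D.coh (𝟙 D.uJ) W.mu ≫ p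

/-- The left `J`-action `γ_J = π^R_∘.(ϖ∘A).(J∘ι^R_∘)` on the retract `R_∘`. -/
def gamJ : D.co D.uJ R ⟶ R :=
  D.coh (𝟙 D.uJ) i ≫ eqToHom (D.coA D.uJ D.uJ W.A).symm ≫ D.coh D.pw (𝟙 W.A) ≫ p

/-- The multiplication `μ^R_∘ = (R∘•ϖ).(R∘•(J∘ε)).(R∘•ι^R_∘).χ^R_{R∘,R∘}`. -/
def muR : D.bu R R ⟶ R :=
  W.chiR R R (W.gamA R p i) (W.gamA R p i)
    ≫ D.buh (𝟙 R) i
    ≫ D.buh (𝟙 R) (D.coh (𝟙 D.uJ) W.ep)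
    ≫ D.buh (𝟙 R) D.pw
    ≫ eqToHom (D.buR R)

/-- The unit `η^R_∘ = π^R_∘.(J∘η)`. -/
def etaR : D.uJ ⟶ R := W.jeta ≫ p

/-- The comultiplication `Δ^R_∘ = χ^R_{R∘,R∘}.(R∘•π^R_∘).(R∘•(J∘η))`. -/
def DeltaR : R ⟶ D.bu R R :=
  eqToHom (D.buR R).symm
    ≫ D.buh (𝟙 R) W.jeta
    ≫ D.buh (𝟙 R) p
    ≫ W.chiR R R (W.gamA R p i) (W.gamA R p i)

/-- The counit `ε^R_∘ = ϖ.(J∘ε).ι^R_∘`. -/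
def epsR : R ⟶ D.uJ := i ≫ D.coh (𝟙 D.uJ) W.ep ≫ D.pw

end Retract

/-- The comultiplication-type morphism `ζ.(J∘Δ) : J∘A ⟶ (J∘A)•(J∘A)`. -/
def coact0 : W.JA ⟶ D.bu W.JA W.JA :=
  D.coh (𝟙 D.uJ) W.dl
    ≫ eqToHom (show D.co D.uJ (D.bu W.A W.A)
        = D.co (D.bu D.uJ D.uJ) (D.bu W.A W.A) by simp [D.buL])
    ≫ D.zt D.uJ D.uJ W.A W.A

end RWB

/-- A morphism of `C` bundled with its source and target. -/
@[ext] structure Ar (C : Type u) [Category.{v} C] where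
  s : C
  t : C
  f : s ⟶ t

namespace Ar

variable {C : Type u} [Category.{v} C]

/-- The identity arrow. -/
def one (X : C) : Ar C := ⟨X, X, 𝟙 X⟩

/-- The target of the first arrow is the source of the second one. -/
structure Fits (a b : Ar C) : Prop where
  eq : a.t = b.s

/-- Composition of arrows whose inner ends are propositionally equal. -/
def comp (a b : Ar C) (h : Fits a b := by exact ⟨by simp⟩) : Ar C :=
  ⟨a.s, b.t, a.f ≫ eqToHom h.eq ≫ b.f⟩

local notation:60 x:61 "⬝" y:60 => Ar.comp x y

@[simp] lemma one_s (X : C) : (one X).s = X := rfl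
@[simp] lemma one_t (X : C) : (one X).t = X := rfl
@[simp] lemma comp_s (a b : Ar C) (h : Fits a b) : (a.comp b h).s = a.s := rfl
@[simp] lemma comp_t (a b : Ar C) (h : Fits a b) : (a.comp b h).t = b.t := rfl

lemma Fits.of_comp {a b c : Ar C} {h : Fits a b} (h' : Fits (a.comp b h) c) : Fits b c := ⟨h'.eq⟩

lemma Fits.comp {a b c : Ar C} (h : Fits a b) (h' : Fits b c) : Fits a (b.comp c h') := ⟨h.eq⟩

@[simp] lemma comp_assoc (a b c : Ar C) (h : Fits a b) (h' : Fits (a.comp b h) c) :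
    (a.comp b h).comp c h' = a.comp (b.comp c (Fits.of_comp h')) (Fits.comp h _) := by
  simp [comp]

@[simp] lemma comp_one (a : Ar C) (X : C) (h : Fits a (one X)) : a.comp (one X) h = a := by
  obtain ⟨s, t, f⟩ := a
  obtain rfl : t = X := h.eq
  change (⟨s, t, f ≫ 𝟙 t ≫ 𝟙 t⟩ : Ar C) = _
  simp

@[simp] lemma one_comp (a : Ar C) (X : C) (h : Fits (one X) a) : (one X).comp a h = a := by
  obtain ⟨s, t, f⟩ := a
  obtain rfl : X = s := h.eq
  simp [comp, one]

lemma comp_congr {a b a' b' : Ar C} {h : Fits a b} (e : a = a') (e' : b = b') :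
    a.comp b h = a'.comp b' (by rw [← e, ← e']; exact h) := by
  subst e e'; rfl

lemma comp_left (x : Ar C) {a b : Ar C} (e : a = b) (h : Fits x a := by exact ⟨by simp⟩) :
    x.comp a h = x.comp b (by rw [← e]; exact h) := comp_congr rfl e

lemma comp_right (x : Ar C) {a b : Ar C} (e : a = b) (h : Fits a x := by exact ⟨by simp⟩) :
    a.comp x h = b.comp x (by rw [← e]; exact h) := comp_congr e rfl

lemma reassoc {a b r : Ar C} {h : Fits a b} (e : a.comp b h = r) (x : Ar C)
    (h₁ : Fits b x) (h₂ : Fits a (b.comp x h₁)) :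
    a.comp (b.comp x h₁) h₂ = r.comp x (by rw [← e]; exact ⟨h₁.eq⟩) := by
  subst e; simp

lemma reassoc₃ {a b c r : Ar C} {h₀ : Fits b c} {h : Fits a (b.comp c h₀)}
    (e : a.comp (b.comp c h₀) h = r) (x : Ar C)
    (h₁ : Fits c x) (h₂ : Fits b (c.comp x h₁)) (h₃ : Fits a (b.comp (c.comp x h₁) h₂)) :
    a.comp (b.comp (c.comp x h₁) h₂) h₃ = r.comp x (by rw [← e]; exact ⟨h₁.eq⟩) := by
  subst e; simp

lemma reassoc₄ {a b c d r : Ar C} {h : Fits c d} {h₀ : Fits b (c.comp d h)}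
    {h' : Fits a (b.comp (c.comp d h) h₀)}
    (e : a.comp (b.comp (c.comp d h) h₀) h' = r) (x : Ar C)
    (h₁ : Fits d x) (h₂ : Fits c (d.comp x h₁)) (h₃ : Fits b (c.comp (d.comp x h₁) h₂))
    (h₄ : Fits a (b.comp (c.comp (d.comp x h₁) h₂) h₃)) :
    a.comp (b.comp (c.comp (d.comp x h₁) h₂) h₃) h₄
      = r.comp x (by rw [← e]; exact ⟨h₁.eq⟩) := by
  subst e; simp

lemma mk_inj {X Y : C} {f g : X ⟶ Y} : (⟨X, Y, f⟩ : Ar C) = ⟨X, Y, g⟩ ↔ f = g := by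
  simp

lemma mk_comp {X Y Z : C} (f : X ⟶ Y) (g : Y ⟶ Z) :
    (⟨X, Z, f ≫ g⟩ : Ar C) = comp ⟨X, Y, f⟩ ⟨Y, Z, g⟩ ⟨rfl⟩ := by
  simp [comp]

lemma mk_id (X : C) : (⟨X, X, 𝟙 X⟩ : Ar C) = one X := rfl

lemma mk_eqToHom {X Y : C} (h : X = Y) : (⟨X, Y, eqToHom h⟩ : Ar C) = one X := by
  subst h; rfl

end Ar

namespace Duo

variable {M : Type u} [Category.{v} M] (D : Duo M)

attribute [local simp] coA coL coR buA buL buR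

/-- The first monoidal product of arrows. -/
def aco (a b : Ar M) : Ar M := ⟨D.co a.s b.s, D.co a.t b.t, D.coh a.f b.f⟩

/-- The second monoidal product of arrows. -/
def abu (a b : Ar M) : Ar M := ⟨D.bu a.s b.s, D.bu a.t b.t, D.buh a.f b.f⟩

/-- The interchange arrow. -/
def Z (A B C E : M) : Ar M := ⟨_, _, D.zt A B C E⟩

/-- The arrow `ϖ`. -/
def aw : Ar M := ⟨_, _, D.pw⟩

/-- The arrow `δ`. -/
def ad : Ar M := ⟨_, _, D.dlI⟩

/-- The arrow `τ`. -/
def atau : Ar M := ⟨_, _, D.tau⟩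

local notation:60 x:61 "⬝" y:60 => Ar.comp x y
local notation:70 x:71 "⊚" y:70 => Duo.aco D x y
local notation:70 x:71 "⊡" y:70 => Duo.abu D x y
local notation "⟪" X "⟫" => Ar.one X

lemma mk_coh {X Y X' Y' : M} (f : X ⟶ Y) (g : X' ⟶ Y') :
    (⟨_, _, D.coh f g⟩ : Ar M) = ⟨X, Y, f⟩ ⊚ ⟨X', Y', g⟩ := rfl

lemma mk_buh {X Y X' Y' : M} (f : X ⟶ Y) (g : X' ⟶ Y') :
    (⟨_, _, D.buh f g⟩ : Ar M) = ⟨X, Y, f⟩ ⊡ ⟨X', Y', g⟩ := rfl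

lemma mk_zt (A B C E : M) : (⟨_, _, D.zt A B C E⟩ : Ar M) = D.Z A B C E := rfl
lemma mk_pw : (⟨_, _, D.pw⟩ : Ar M) = D.aw := rfl
lemma mk_dlI : (⟨_, _, D.dlI⟩ : Ar M) = D.ad := rfl
lemma mk_tau : (⟨_, _, D.tau⟩ : Ar M) = D.atau := rfl

@[simp] lemma aco_s (a b : Ar M) : (a ⊚ b).s = D.co a.s b.s := rfl
@[simp] lemma aco_t (a b : Ar M) : (a ⊚ b).t = D.co a.t b.t := rfl
@[simp] lemma abu_s (a b : Ar M) : (a ⊡ b).s = D.bu a.s b.s := rfl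
@[simp] lemma abu_t (a b : Ar M) : (a ⊡ b).t = D.bu a.t b.t := rfl
@[simp] lemma Z_s (A B C E : M) : (D.Z A B C E).s = D.co (D.bu A B) (D.bu C E) := rfl
@[simp] lemma Z_t (A B C E : M) : (D.Z A B C E).t = D.bu (D.co A C) (D.co B E) := rfl
@[simp] lemma aw_s : D.aw.s = D.co D.uJ D.uJ := rfl
@[simp] lemma aw_t : D.aw.t = D.uJ := rfl
@[simp] lemma ad_s : D.ad.s = D.uI := rfl
@[simp] lemma ad_t : D.ad.t = D.bu D.uI D.uI := rfl
@[simp] lemma atau_s : D.atau.s = D.uI := rfl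
@[simp] lemma atau_t : D.atau.t = D.uJ := rfl

@[simp] lemma one_aco_one (X Y : M) : ⟪X⟫ ⊚ ⟪Y⟫ = ⟪D.co X Y⟫ := by
  simp [aco, Ar.one, D.coh_id]
@[simp] lemma one_abu_one (X Y : M) : ⟪X⟫ ⊡ ⟪Y⟫ = ⟪D.bu X Y⟫ := by
  simp [abu, Ar.one, D.buh_id]

lemma _root_.Ar.eq_of_conj {X Y X' Y' : M} {f : X ⟶ Y} {g : X' ⟶ Y'} (h : X = X') (h' : Y' = Y)
    (e : f = eqToHom h ≫ g ≫ eqToHom h') : (⟨X, Y, f⟩ : Ar M) = ⟨X', Y', g⟩ := by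
  subst h h'; simp [e]

@[simp] lemma aco_assoc (a b c : Ar M) : (a ⊚ b) ⊚ c = a ⊚ b ⊚ c :=
  Ar.eq_of_conj _ _ (D.coh_assoc a.f b.f c.f)
@[simp] lemma abu_assoc (a b c : Ar M) : (a ⊡ b) ⊡ c = a ⊡ b ⊡ c :=
  Ar.eq_of_conj _ _ (D.buh_assoc a.f b.f c.f)
@[simp] lemma one_aco (a : Ar M) : ⟪D.uI⟫ ⊚ a = a :=
  Ar.eq_of_conj _ _ (D.coh_unitL a.f)
@[simp] lemma aco_one (a : Ar M) : a ⊚ ⟪D.uI⟫ = a :=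
  Ar.eq_of_conj _ _ (D.coh_unitR a.f)
@[simp] lemma one_abu (a : Ar M) : ⟪D.uJ⟫ ⊡ a = a :=
  Ar.eq_of_conj _ _ (D.buh_unitL a.f)
@[simp] lemma abu_one (a : Ar M) : a ⊡ ⟪D.uJ⟫ = a :=
  Ar.eq_of_conj _ _ (D.buh_unitR a.f)
@[simp] lemma one_aco_one_aco (X Y : M) (a : Ar M) :
    ⟪X⟫ ⊚ ⟪Y⟫ ⊚ a = ⟪D.co X Y⟫ ⊚ a := by
  rw [← aco_assoc, one_aco_one]
@[simp] lemma one_abu_one_abu (X Y : M) (a : Ar M) :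
    ⟪X⟫ ⊡ ⟪Y⟫ ⊡ a = ⟪D.bu X Y⟫ ⊡ a := by
  rw [← abu_assoc, one_abu_one]

lemma aco_comp (a b c d : Ar M) (h : Ar.Fits a b) (h' : Ar.Fits c d) :
    a.comp b h ⊚ c.comp d h' = (a ⊚ c).comp (b ⊚ d) ⟨by simp [h.eq, h'.eq]⟩ := by
  obtain ⟨as, atau, a⟩ := a
  obtain ⟨cs, ct, c⟩ := c
  obtain ⟨bs, bt, b⟩ := b
  obtain ⟨ds, dt, d⟩ := d
  obtain rfl : atau = bs := h.eq
  obtain rfl : ct = ds := h'.eq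
  simp [aco, Ar.comp, D.coh_comp]

lemma abu_comp (a b c d : Ar M) (h : Ar.Fits a b) (h' : Ar.Fits c d) :
    a.comp b h ⊡ c.comp d h' = (a ⊡ c).comp (b ⊡ d) ⟨by simp [h.eq, h'.eq]⟩ := by
  obtain ⟨as, atau, a⟩ := a
  obtain ⟨cs, ct, c⟩ := c
  obtain ⟨bs, bt, b⟩ := b
  obtain ⟨ds, dt, d⟩ := d
  obtain rfl : atau = bs := h.eq
  obtain rfl : ct = ds := h'.eq
  simp [abu, Ar.comp, D.buh_comp]

lemma one_aco_comp (X : M) (a b : Ar M) (h : Ar.Fits a b) :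
    ⟪X⟫ ⊚ a.comp b h = (⟪X⟫ ⊚ a).comp (⟪X⟫ ⊚ b) ⟨by simp [h.eq]⟩ := by
  simpa using D.aco_comp ⟪X⟫ ⟪X⟫ a b ⟨by simp⟩ h
lemma comp_aco_one (X : M) (a b : Ar M) (h : Ar.Fits a b) :
    a.comp b h ⊚ ⟪X⟫ = (a ⊚ ⟪X⟫).comp (b ⊚ ⟪X⟫) ⟨by simp [h.eq]⟩ := by
  simpa using D.aco_comp a b ⟪X⟫ ⟪X⟫ h ⟨by simp⟩
lemma one_abu_comp (X : M) (a b : Ar M) (h : Ar.Fits a b) :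
    ⟪X⟫ ⊡ a.comp b h = (⟪X⟫ ⊡ a).comp (⟪X⟫ ⊡ b) ⟨by simp [h.eq]⟩ := by
  simpa using D.abu_comp ⟪X⟫ ⟪X⟫ a b ⟨by simp⟩ h
lemma comp_abu_one (X : M) (a b : Ar M) (h : Ar.Fits a b) :
    a.comp b h ⊡ ⟪X⟫ = (a ⊡ ⟪X⟫).comp (b ⊡ ⟪X⟫) ⟨by simp [h.eq]⟩ := by
  simpa using D.abu_comp a b ⟪X⟫ ⟪X⟫ h ⟨by simp⟩

lemma aco_left_right (a b : Ar M) : a ⊚ b = (a ⊚ ⟪b.s⟫) ⬝ (⟪a.t⟫ ⊚ b) := by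
  simpa using D.aco_comp a ⟪a.t⟫ ⟪b.s⟫ b ⟨by simp⟩ ⟨by simp⟩
lemma aco_right_left (a b : Ar M) : a ⊚ b = (⟪a.s⟫ ⊚ b) ⬝ (a ⊚ ⟪b.t⟫) := by
  simpa using D.aco_comp ⟪a.s⟫ a b ⟪b.t⟫ ⟨by simp⟩ ⟨by simp⟩
lemma abu_left_right (a b : Ar M) : a ⊡ b = (a ⊡ ⟪b.s⟫) ⬝ (⟪a.t⟫ ⊡ b) := by
  simpa using D.abu_comp a ⟪a.t⟫ ⟪b.s⟫ b ⟨by simp⟩ ⟨by simp⟩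
lemma abu_right_left (a b : Ar M) : a ⊡ b = (⟪a.s⟫ ⊡ b) ⬝ (a ⊡ ⟪b.t⟫) := by
  simpa using D.abu_comp ⟪a.s⟫ a b ⟪b.t⟫ ⟨by simp⟩ ⟨by simp⟩

lemma Z_nat (a b c d : Ar M) :
    ((a ⊡ b) ⊚ (c ⊡ d)) ⬝ D.Z a.t b.t c.t d.t
      = D.Z a.s b.s c.s d.s ⬝ (a ⊚ c) ⊡ (b ⊚ d) := by
  have := D.zt_nat a.f b.f c.f d.f
  simp only [← Ar.mk_inj, Ar.mk_comp] at this
  exact this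

lemma Z_assoc (A B C E F G : M) :
    (D.Z A B C E ⊚ ⟪D.bu F G⟫) ⬝ D.Z (D.co A C) (D.co B E) F G
      = (⟪D.bu A B⟫ ⊚ D.Z C E F G) ⬝ D.Z A B (D.co C F) (D.co E G) := by
  have := D.zt_assoc1 A B C E F G
  simp only [← Ar.mk_inj, Ar.mk_comp, mk_coh, Ar.mk_eqToHom, Ar.mk_id, Ar.one_comp,
    Ar.comp_one] at this
  exact this

lemma Z_coassoc (A B C E F G : M) :
    D.Z (D.bu A B) C (D.bu E F) G ⬝ (D.Z A B E F ⊡ ⟪D.co C G⟫)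
      = D.Z A (D.bu B C) E (D.bu F G) ⬝ (⟪D.co A E⟫ ⊡ D.Z B C F G) := by
  have := D.zt_assoc2 A B C E F G
  simp only [← Ar.mk_inj, Ar.mk_comp, mk_buh, Ar.mk_eqToHom, Ar.mk_id, Ar.one_comp,
    Ar.comp_one] at this
  exact this

lemma ad_Z (A B : M) : ((⟪D.bu A B⟫ ⊚ D.ad) ⬝ D.Z A B D.uI D.uI) = ⟪D.bu A B⟫ := by
  have := D.zt_unitB A B
  simp only [← Ar.mk_inj, Ar.mk_comp, mk_coh, Ar.mk_eqToHom, Ar.mk_id, Ar.one_comp,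
    Ar.comp_one] at this
  exact this

lemma Z_aw_left (A B : M) : D.Z D.uJ A D.uJ B ⬝ (D.aw ⊡ ⟪D.co A B⟫) = ⟪D.co A B⟫ := by
  have := D.zt_unitC A B
  simp only [← Ar.mk_inj, Ar.mk_comp, mk_buh, Ar.mk_eqToHom, Ar.mk_id, Ar.one_comp,
    Ar.comp_one] at this
  exact this

lemma Z_aw_right (A B : M) : D.Z A D.uJ B D.uJ ⬝ (⟪D.co A B⟫ ⊡ D.aw) = ⟪D.co A B⟫ := by
  have := D.zt_unitD A B
  simp only [← Ar.mk_inj, Ar.mk_comp, mk_buh, Ar.mk_eqToHom, Ar.mk_id, Ar.one_comp,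
    Ar.comp_one] at this
  exact this

lemma aw_assoc : (D.aw ⊚ ⟪D.uJ⟫) ⬝ D.aw = (⟪D.uJ⟫ ⊚ D.aw) ⬝ D.aw := by
  have := D.pw_assoc
  simp only [← Ar.mk_inj, Ar.mk_comp, mk_coh, Ar.mk_eqToHom, Ar.mk_id, Ar.one_comp] at this
  exact this

lemma at_aw : (D.atau ⊚ ⟪D.uJ⟫) ⬝ D.aw = ⟪D.uJ⟫ := by
  have := D.pw_unitL
  simp only [← Ar.mk_inj, Ar.mk_comp, mk_coh, Ar.mk_eqToHom, Ar.mk_id, Ar.one_comp] at this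
  exact this

lemma ad_at_left : D.ad ⬝ (D.atau ⊡ ⟪D.uI⟫) = ⟪D.uI⟫ := by
  have := D.dlI_counitL
  simp only [← Ar.mk_inj, Ar.mk_comp, mk_buh, Ar.mk_eqToHom, Ar.mk_id,
    Ar.comp_one] at this
  exact this

lemma ad_at_right : D.ad ⬝ (⟪D.uI⟫ ⊡ D.atau) = ⟪D.uI⟫ := by
  have := D.dlI_counitR
  simp only [← Ar.mk_inj, Ar.mk_comp, mk_buh, Ar.mk_eqToHom, Ar.mk_id,
    Ar.comp_one] at this
  exact this

end Duo

namespace RWB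

variable {M : Type u} [Category.{v} M] {D : Duo M} (W : RWB D)

local notation:60 x:61 "⬝" y:60 => Ar.comp x y
local notation:70 x:71 "⊚" y:70 => Duo.aco D x y
local notation:70 x:71 "⊡" y:70 => Duo.abu D x y
local notation "⟪" X "⟫" => Ar.one X

attribute [local simp] Duo.coA Duo.coL Duo.coR Duo.buA Duo.buL Duo.buR
  Duo.one_aco_comp Duo.comp_aco_one Duo.one_abu_comp Duo.comp_abu_one

/-- The multiplication as an arrow. -/
def am : Ar M := ⟨_, _, W.mu⟩

/-- The unit as an arrow. -/
def an : Ar M := ⟨_, _, W.eta⟩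

/-- The comultiplication as an arrow. -/
def al : Ar M := ⟨_, _, W.dl⟩

/-- The counit as an arrow. -/
def ae : Ar M := ⟨_, _, W.ep⟩

lemma mk_mu : (⟨_, _, W.mu⟩ : Ar M) = W.am := rfl
lemma mk_eta : (⟨_, _, W.eta⟩ : Ar M) = W.an := rfl
lemma mk_dl : (⟨_, _, W.dl⟩ : Ar M) = W.al := rfl
lemma mk_ep : (⟨_, _, W.ep⟩ : Ar M) = W.ae := rfl

@[simp] lemma am_s : W.am.s = D.co W.A W.A := rfl
@[simp] lemma am_t : W.am.t = W.A := rfl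
@[simp] lemma an_s : W.an.s = D.uI := rfl
@[simp] lemma an_t : W.an.t = W.A := rfl
@[simp] lemma al_s : W.al.s = W.A := rfl
@[simp] lemma al_t : W.al.t = D.bu W.A W.A := rfl
@[simp] lemma ae_s : W.ae.s = W.A := rfl
@[simp] lemma ae_t : W.ae.t = D.uJ := rfl

lemma am_assoc : (W.am ⊚ ⟪W.A⟫) ⬝ W.am = (⟪W.A⟫ ⊚ W.am) ⬝ W.am := by
  have := W.mu_assoc
  simp only [← Ar.mk_inj, Ar.mk_comp, Duo.mk_coh, Ar.mk_eqToHom, Ar.mk_id, Ar.one_comp] at this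
  exact this

lemma an_am : (W.an ⊚ ⟪W.A⟫) ⬝ W.am = ⟪W.A⟫ := by
  have := W.mu_unitL
  simp only [← Ar.mk_inj, Ar.mk_comp, Duo.mk_coh, Ar.mk_eqToHom, Ar.mk_id, Ar.one_comp] at this
  exact this

lemma an_am' : (⟪W.A⟫ ⊚ W.an) ⬝ W.am = ⟪W.A⟫ := by
  have := W.mu_unitR
  simp only [← Ar.mk_inj, Ar.mk_comp, Duo.mk_coh, Ar.mk_eqToHom, Ar.mk_id, Ar.one_comp] at this
  exact this

lemma al_coassoc : W.al ⬝ (W.al ⊡ ⟪W.A⟫) = W.al ⬝ (⟪W.A⟫ ⊡ W.al) := by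
  have := W.dl_coassoc
  simp only [← Ar.mk_inj, Ar.mk_comp, Duo.mk_buh, Ar.mk_eqToHom, Ar.mk_id, Ar.comp_one] at this
  exact this

lemma al_ae_left : W.al ⬝ (W.ae ⊡ ⟪W.A⟫) = ⟪W.A⟫ := by
  have := W.dl_counitL
  simp only [← Ar.mk_inj, Ar.mk_comp, Duo.mk_buh, Ar.mk_eqToHom, Ar.mk_id, Ar.comp_one] at this
  exact this

lemma al_ae_right : W.al ⬝ (⟪W.A⟫ ⊡ W.ae) = ⟪W.A⟫ := by
  have := W.dl_counitR
  simp only [← Ar.mk_inj, Ar.mk_comp, Duo.mk_buh, Ar.mk_eqToHom, Ar.mk_id, Ar.comp_one] at this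
  exact this

lemma am_al : W.am ⬝ W.al = (W.al ⊚ W.al) ⬝ D.Z W.A W.A W.A W.A ⬝ (W.am ⊡ W.am) := by
  have := W.wb
  simp only [Duo.WBeq, ← Ar.mk_inj, Ar.mk_comp, Duo.mk_coh, Duo.mk_buh] at this
  exact this

/-- The arrow `Δ.η : I ⟶ A•A`. -/
def ah : Ar M := W.an ⬝ W.al

@[simp] lemma ah_s : W.ah.s = D.uI := rfl
@[simp] lemma ah_t : W.ah.t = D.bu W.A W.A := rfl

/-- The arrow `ζ.((X•Y)∘(Δ.η)) : X•Y ⟶ (X∘A)•(Y∘A)`. -/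
def Q (X Y : M) : Ar M := (⟪D.bu X Y⟫ ⊚ W.ah) ⬝ D.Z X Y W.A W.A

@[simp] lemma Q_s (X Y : M) : (W.Q X Y).s = D.bu X Y := by simp [Q]
@[simp] lemma Q_t (X Y : M) : (W.Q X Y).t = D.bu (D.co X W.A) (D.co Y W.A) := rfl

lemma Q_nat (f g : Ar M) :
    (f ⊡ g) ⬝ W.Q f.t g.t = W.Q f.s g.s ⬝ (f ⊚ ⟪W.A⟫) ⊡ (g ⊚ ⟪W.A⟫) := by
  have e₁ := (D.aco_left_right (f ⊡ g) W.ah).symm.trans (D.aco_right_left _ _)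
  have e₂ := D.Z_nat f g ⟪W.A⟫ ⟪W.A⟫
  simp at e₁ e₂
  simp [Q, Ar.reassoc e₁, e₂]

lemma Z_Q (X Y X' Y' : M) :
    D.Z X Y X' Y' ⬝ W.Q (D.co X X') (D.co Y Y')
      = (⟪D.bu X Y⟫ ⊚ W.Q X' Y') ⬝ D.Z X Y (D.co X' W.A) (D.co Y' W.A) := by
  have e₁ := (D.aco_left_right (D.Z X Y X' Y') W.ah).symm.trans (D.aco_right_left _ _)
  have e₂ := D.Z_assoc X Y X' Y' W.A W.A
  simp at e₁ e₂
  simp [Q, Ar.reassoc e₁, e₂]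

/-- The arrow `ϖ.(J∘(ε.μ)) : J∘A∘A ⟶ J`. -/
def em : Ar M := (⟪D.uJ⟫ ⊚ W.am) ⬝ (⟪D.uJ⟫ ⊚ W.ae) ⬝ D.aw

@[simp] lemma em_s : W.em.s = D.co D.uJ (D.co W.A W.A) := rfl
@[simp] lemma em_t : W.em.t = D.uJ := rfl

/-- The idempotent `⊓^R_∘` as an arrow. -/
def sq : Ar M := W.Q D.uJ (D.co D.uJ W.A) ⬝ (⟪D.co D.uJ W.A⟫ ⊡ W.em)

@[simp] lemma sq_s : W.sq.s = D.co D.uJ W.A := by simp [sq]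
@[simp] lemma sq_t : W.sq.t = D.co D.uJ W.A := by simp [sq]

/-- The variant `((ϖ.(J∘(ε.μ)))•(J∘A)).ζ.(J∘A∘(Δ.η))` of `⊓^R_∘` with the two legs exchanged. -/
def sqb : Ar M := W.Q (D.co D.uJ W.A) D.uJ ⬝ (W.em ⊡ ⟪D.co D.uJ W.A⟫)

@[simp] lemma sqb_s : W.sqb.s = D.co D.uJ W.A := by simp [sqb]
@[simp] lemma sqb_t : W.sqb.t = D.co D.uJ W.A := by simp [sqb]

lemma mk_sqcapR : (⟨_, _, W.sqcapR⟩ : Ar M) = W.sq := by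
  have h : W.sqcapR = (eqToHom (by simp)
      ≫ D.coh (𝟙 (D.co D.uJ W.A)) (W.eta ≫ W.dl)
      ≫ eqToHom (by simp)
      ≫ D.zt D.uJ (D.co D.uJ W.A) W.A W.A
      ≫ D.buh (𝟙 (D.co D.uJ W.A))
          (eqToHom (D.coA D.uJ W.A W.A) ≫ D.coh (𝟙 D.uJ) (W.mu ≫ W.ep))
      ≫ D.buh (𝟙 (D.co D.uJ W.A)) D.pw
      ≫ eqToHom (D.buR _) : D.co D.uJ W.A ⟶ D.co D.uJ W.A) := rfl
  rw [h]
  simp only [JA, Ar.mk_comp, Duo.mk_coh, Duo.mk_buh, Ar.mk_eqToHom, Ar.mk_id, Ar.one_comp,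
    Ar.comp_one, mk_mu, mk_eta, mk_dl, mk_ep, Duo.mk_zt, Duo.mk_pw]
  simp [sq, Q, em, ah]

lemma sq_em : (W.sq ⊚ ⟪W.A⟫) ⬝ W.em = W.em := by
  have h := W.llc
  simp only [Duo.LLCeq, ← Ar.mk_inj, Ar.mk_comp, Duo.mk_coh, Duo.mk_buh, Ar.mk_eqToHom, Ar.mk_id,
    Ar.one_comp, mk_mu, mk_dl, mk_ep, Duo.mk_zt, Duo.mk_pw] at h
  have e₀ := Ar.comp_left (⟪D.co D.uJ W.A⟫ ⊚ W.an ⊚ ⟪W.A⟫) h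
  have e₁ := congrArg (⟪D.co D.uJ W.A⟫ ⊚ ·) W.an_am
  simp at e₀ e₁
  simpa [sq, em, ah, Q, Ar.reassoc e₁] using e₀

lemma sqb_em : (W.sqb ⊚ ⟪W.A⟫) ⬝ W.em = W.em := by
  have h := W.lrc
  simp only [Duo.LRCeq, ← Ar.mk_inj, Ar.mk_comp, Duo.mk_coh, Duo.mk_buh, Ar.mk_eqToHom, Ar.mk_id,
    Ar.one_comp, mk_mu, mk_dl, mk_ep, Duo.mk_zt, Duo.mk_pw] at h
  have e₀ := Ar.comp_left (⟪D.co D.uJ W.A⟫ ⊚ W.an ⊚ ⟪W.A⟫) h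
  have e₁ := congrArg (⟪D.co D.uJ W.A⟫ ⊚ ·) W.an_am
  simp at e₀ e₁
  simpa [sqb, em, ah, Q, Ar.reassoc e₁] using e₀

lemma ad_ah_at : D.ad ⬝ (W.ah ⊡ ⟪D.uI⟫) ⬝ (⟪D.bu W.A W.A⟫ ⊡ D.atau) = W.ah := by
  have e₁ := (D.abu_left_right W.ah D.atau).symm.trans (D.abu_right_left _ _)
  simp at e₁
  simp [e₁, Ar.reassoc D.ad_at_right]

lemma lru' : W.ah ⬝ (W.al ⊡ ⟪W.A⟫)
    = D.ad ⬝ (W.ah ⊡ ⟪D.uI⟫) ⬝ (⟪W.A⟫ ⊡ W.Q W.A D.uI) ⬝ (⟪W.A⟫ ⊡ W.am ⊡ ⟪W.A⟫) := by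
  have h := W.lru
  simp only [Duo.LRUeq, ← Ar.mk_inj, Ar.mk_comp, Duo.mk_coh, Duo.mk_buh, Ar.mk_eqToHom, Ar.mk_id,
    Ar.one_comp, mk_mu, mk_eta, mk_dl, Duo.mk_zt, Duo.mk_dlI] at h
  have e₀ := Ar.comp_right (⟪D.bu W.A (D.bu W.A W.A)⟫ ⊡ D.atau) h
  have e₁ := congrArg (⟪W.A⟫ ⊡ ·) (D.Z_nat ⟪W.A⟫ ⟪D.uI⟫ ⟪W.A⟫ (⟪W.A⟫ ⊡ D.atau))
  have e₂ := congrArg (fun x => ⟪W.A⟫ ⊡ (⟪D.bu W.A D.uI⟫ ⊚ x)) W.ad_ah_at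
  have e₃ := congrArg (⟪W.A⟫ ⊡ ·)
    ((D.abu_left_right W.am (⟪W.A⟫ ⊡ D.atau)).symm.trans (D.abu_right_left _ _))
  have e₄ := (D.abu_left_right W.al (⟪W.A⟫ ⊡ D.atau)).symm.trans (D.abu_right_left _ _)
  have e₅ := W.ad_ah_at
  simp [ah] at e₀ e₁ e₂ e₃ e₄ e₅
  simp only [e₄, Ar.reassoc₄ e₅, e₃, Ar.reassoc e₁.symm, Ar.comp_assoc, Ar.reassoc₄ e₂] at e₀
  simpa [ah, Q] using e₀.symm

lemma ad_at_ah : D.ad ⬝ (⟪D.uI⟫ ⊡ W.ah) ⬝ (D.atau ⊡ ⟪D.bu W.A W.A⟫) = W.ah := by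
  have e₁ := (D.abu_left_right D.atau W.ah).symm.trans (D.abu_right_left _ _)
  simp at e₁
  simp [e₁.symm, Ar.reassoc D.ad_at_left]

lemma rru' : W.ah ⬝ (⟪W.A⟫ ⊡ W.al)
    = D.ad ⬝ (⟪D.uI⟫ ⊡ W.ah) ⬝ (W.Q D.uI W.A ⊡ ⟪W.A⟫) ⬝ (⟪W.A⟫ ⊡ W.am ⊡ ⟪W.A⟫) := by
  have h := W.rru
  simp only [Duo.RRUeq, ← Ar.mk_inj, Ar.mk_comp, Duo.mk_coh, Duo.mk_buh, Ar.mk_eqToHom, Ar.mk_id,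
    Ar.one_comp, Ar.comp_one, mk_mu, mk_eta, mk_dl, Duo.mk_zt, Duo.mk_dlI] at h
  have e₀ := Ar.comp_right (D.atau ⊡ ⟪D.bu W.A (D.bu W.A W.A)⟫) h
  have e₁ := congrArg (· ⊡ ⟪W.A⟫) (D.Z_nat ⟪D.uI⟫ ⟪W.A⟫ (D.atau ⊡ ⟪W.A⟫) ⟪W.A⟫)
  have e₂ := congrArg (fun x => (⟪D.bu D.uI W.A⟫ ⊚ x) ⊡ ⟪W.A⟫) W.ad_at_ah
  have e₃ := congrArg (· ⊡ ⟪W.A⟫)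
    ((D.abu_left_right (D.atau ⊡ ⟪W.A⟫) W.am).symm.trans (D.abu_right_left _ _))
  have e₄ := (D.abu_left_right (D.atau ⊡ ⟪W.A⟫) W.al).symm.trans (D.abu_right_left _ _)
  have e₅ := W.ad_at_ah
  simp [ah] at e₀ e₁ e₂ e₃ e₄ e₅
  simp only [← e₄, Ar.reassoc₄ e₅, ← e₃, Ar.reassoc e₁.symm, Ar.comp_assoc, Ar.reassoc₄ e₂] at e₀
  simpa [ah, Q] using e₀.symm

lemma aco_em_aw : (⟪D.uJ⟫ ⊚ W.em) ⬝ D.aw = (D.aw ⊚ ⟪D.co W.A W.A⟫) ⬝ W.em := by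
  have e₁ := (D.aco_left_right D.aw W.am).symm.trans (D.aco_right_left _ _)
  have e₂ := (D.aco_left_right D.aw W.ae).symm.trans (D.aco_right_left _ _)
  simp at e₁ e₂
  simp [em, Ar.reassoc e₁, Ar.reassoc e₂, D.aw_assoc]

lemma aw_sq : (D.aw ⊚ ⟪W.A⟫) ⬝ W.sq = (⟪D.uJ⟫ ⊚ W.sq) ⬝ (D.aw ⊚ ⟪W.A⟫) := by
  have e₁ := Ar.comp_left (⟪D.uJ⟫ ⊚ (⟪D.co D.uJ W.A⟫ ⊡ W.em)) (D.Z_aw_right D.uJ (D.co D.uJ W.A))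
  have e₂ := D.Z_nat ⟪D.uJ⟫ ⟪D.uJ⟫ ⟪D.co D.uJ W.A⟫ W.em
  have e₃ := W.Z_Q D.uJ D.uJ D.uJ (D.co D.uJ W.A)
  have e₄ := congrArg (⟪D.co D.uJ (D.co D.uJ W.A)⟫ ⊡ ·) W.aco_em_aw
  have e₅ := W.Q_nat D.aw (D.aw ⊚ ⟪W.A⟫)
  have e₆ := Ar.comp_right (D.aw ⊚ ⟪W.A⟫) (D.Z_aw_left D.uJ (D.co D.uJ W.A))
  have e₇ := D.abu_left_right D.aw (D.aw ⊚ ⟪W.A⟫)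
  have e₈ := D.abu_right_left (D.aw ⊚ ⟪W.A⟫) ((D.aw ⊚ ⟪D.co W.A W.A⟫) ⬝ W.em)
  have e₉ := D.abu_comp (D.aw ⊚ ⟪W.A⟫) ⟪D.co D.uJ W.A⟫ (D.aw ⊚ ⟪D.co W.A W.A⟫) W.em
    ⟨by simp⟩ ⟨by simp⟩
  simp at e₂ e₃ e₄ e₅ e₇ e₈ e₉
  simp [Ar.reassoc e₂, ← e₇] at e₁ e₆
  refine (Ar.comp_right W.sq e₆.symm).trans ?_
  simp only [sq, Duo.one_aco_comp, ← e₁, e₄, Ar.reassoc e₃.symm, ← e₈, Ar.comp_assoc,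
    Ar.reassoc e₅, ← e₉]

lemma sqb_sq : W.sqb ⬝ W.sq = W.sq := by
  have e₁ := W.Q_nat ⟪D.uJ⟫ W.sqb
  have e₂ := congrArg (⟪D.co D.uJ W.A⟫ ⊡ ·) W.sqb_em
  simp at e₁ e₂
  simp only [sq, Ar.reassoc e₁, Ar.comp_assoc, e₂]

/-- The arrow `ϖ.(J∘ε) : J∘A ⟶ J`. -/
def ej : Ar M := (⟪D.uJ⟫ ⊚ W.ae) ⬝ D.aw

@[simp] lemma ej_s : W.ej.s = D.co D.uJ W.A := rfl
@[simp] lemma ej_t : W.ej.t = D.uJ := rfl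

lemma sq_ej : W.sq ⬝ W.ej = W.ej := by
  have e₁ := Ar.comp_left (⟪D.co D.uJ W.A⟫ ⊚ W.an) W.sq_em
  have e₂ := (D.aco_left_right W.sq W.an).symm.trans (D.aco_right_left _ _)
  have e₃ := congrArg (⟪D.uJ⟫ ⊚ ·) W.an_am'
  simp at e₁ e₂ e₃
  simp only [Ar.reassoc e₂.symm, Ar.comp_assoc] at e₁
  simpa [em, ej, Ar.reassoc e₃] using e₁

/-- The arrow `J∘μ : J∘A∘A ⟶ J∘A`. -/
def jm : Ar M := ⟪D.uJ⟫ ⊚ W.am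

@[simp] lemma jm_s : W.jm.s = D.co D.uJ (D.co W.A W.A) := rfl
@[simp] lemma jm_t : W.jm.t = D.co D.uJ W.A := rfl

lemma jm_em : (W.jm ⊚ ⟪W.A⟫) ⬝ W.em = (⟪D.co D.uJ W.A⟫ ⊚ W.am) ⬝ W.em := by
  have e₁ := congrArg (⟪D.uJ⟫ ⊚ ·) W.am_assoc
  simp at e₁
  simp [jm, em, Ar.reassoc e₁]

lemma jm_sq : W.jm ⬝ W.sq = (W.sq ⊚ ⟪W.A⟫) ⬝ W.jm ⬝ W.sq := by
  have e₁ := W.Q_nat ⟪D.uJ⟫ W.jm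
  have e₂ := congrArg (⟪D.co D.uJ W.A⟫ ⊡ ·) W.jm_em
  have e₃ := W.Q_nat ⟪D.uJ⟫ (W.sq ⊚ ⟪W.A⟫)
  have e₄ := (D.aco_left_right W.sq W.am).symm.trans (D.aco_right_left _ _)
  have e₅ := congrArg (⟪D.co D.uJ W.A⟫ ⊡ ·) e₄
  have e₆ := congrArg (⟪D.co D.uJ W.A⟫ ⊡ ·) W.sq_em
  simp at e₁ e₂ e₃ e₅ e₆
  conv_lhs => simp only [sq, Ar.reassoc e₁, e₂]
  conv_rhs =>
    enter [2, 2]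
    rw [sq]
  simp only [Ar.reassoc e₁, e₂, Ar.comp_assoc, Ar.reassoc e₃, Ar.reassoc e₅, e₆]

lemma al_Q : W.al ⬝ W.Q W.A W.A ⬝ (W.am ⊡ W.am) = W.al := by
  have e₁ := Ar.comp_left (⟪W.A⟫ ⊚ W.an) W.am_al
  have e₂ := (D.aco_left_right W.al W.al)
  have e₃ := (D.aco_left_right W.al W.an).symm.trans (D.aco_right_left _ _)
  simp at e₁ e₂ e₃
  simp only [Ar.reassoc W.an_am', e₂, Ar.one_comp, Ar.comp_assoc, Ar.reassoc e₃.symm] at e₁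
  simpa [Q, ah] using e₁.symm

/-- The arrow `(μ•(J∘A)).ζ.(A∘(Δ.η)) : A ⟶ A•(J∘A)`. -/
def uR : Ar M := W.Q W.A D.uJ ⬝ (W.am ⊡ ⟪D.co D.uJ W.A⟫)

@[simp] lemma uR_s : W.uR.s = W.A := by simp [uR]
@[simp] lemma uR_t : W.uR.t = D.bu W.A (D.co D.uJ W.A) := by simp [uR]

/-- The arrow `((J∘A)•μ).ζ.(A∘(Δ.η)) : A ⟶ (J∘A)•A`. -/
def uL : Ar M := W.Q D.uJ W.A ⬝ (⟪D.co D.uJ W.A⟫ ⊡ W.am)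

@[simp] lemma uL_s : W.uL.s = W.A := by simp [uL]
@[simp] lemma uL_t : W.uL.t = D.bu (D.co D.uJ W.A) W.A := by simp [uL]

lemma uR_al_eq_lru : W.uR ⬝ (W.al ⊡ ⟪D.co D.uJ W.A⟫)
    = W.al ⬝ (⟪D.bu W.A W.A⟫ ⊚ (W.ah ⬝ (W.al ⊡ ⟪W.A⟫))) ⬝ D.Z W.A W.A W.A (D.bu W.A W.A)
      ⬝ (⟪D.co W.A W.A⟫ ⊡ D.Z W.A D.uJ W.A W.A) ⬝ (W.am ⊡ W.am ⊡ ⟪D.co D.uJ W.A⟫) := by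
  have e₁ := D.Z_nat W.al ⟪D.uJ⟫ W.al ⟪W.A⟫
  have e₂ := Ar.comp_right (W.am ⊡ W.am ⊡ ⟪D.co D.uJ W.A⟫) (D.Z_coassoc W.A W.A D.uJ W.A W.A W.A)
  have e₃ := congrArg (· ⊡ ⟪D.co D.uJ W.A⟫) W.am_al
  have e₄ := D.aco_left_right W.al (W.al ⊡ ⟪W.A⟫)
  have e₅ := (D.aco_left_right W.al W.ah).symm.trans (D.aco_right_left _ _)
  simp at e₁ e₂ e₃ e₄ e₅
  simp only [uR, Q, D.buR, Ar.comp_assoc, e₃, Ar.reassoc e₁.symm, e₂, e₄, Ar.reassoc e₅.symm,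
    Duo.one_aco_comp]

lemma lru_Z : (⟪D.bu W.A W.A⟫ ⊚ (W.ah ⬝ (W.al ⊡ ⟪W.A⟫))) ⬝ D.Z W.A W.A W.A (D.bu W.A W.A)
      ⬝ (⟪D.co W.A W.A⟫ ⊡ D.Z W.A D.uJ W.A W.A)
    = W.Q W.A W.A ⬝ (⟪D.co W.A W.A⟫ ⊡
        (W.Q (D.co W.A W.A) D.uJ ⬝ ((⟪W.A⟫ ⊚ W.am) ⊡ ⟪D.co D.uJ W.A⟫))) := by
  have e₁ := D.Z_nat ⟪W.A⟫ ⟪W.A⟫ ⟪W.A⟫ (W.Q W.A D.uI ⬝ (W.am ⊡ ⟪W.A⟫))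
  have e₂ := congrArg (⟪D.co W.A W.A⟫ ⊡ ·) (W.Z_Q W.A D.uJ W.A D.uI)
  have e₃ := congrArg (⟪D.co W.A W.A⟫ ⊡ ·) (D.Z_nat ⟪W.A⟫ ⟪D.uJ⟫ W.am ⟪W.A⟫)
  have e₄ := D.Z_coassoc W.A W.A D.uJ W.A W.A D.uI
  have e₅ := D.Z_nat ⟪D.bu W.A W.A⟫ ⟪D.uJ⟫ W.ah ⟪D.uI⟫
  have e₆ := D.ad_Z (D.bu W.A W.A) D.uJ
  simp at e₁ e₂ e₃ e₄ e₅ e₆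
  simp only [W.lru', Duo.one_aco_comp, Ar.comp_assoc, Ar.reassoc₃ e₁, e₃, Ar.reassoc e₂.symm,
    Ar.reassoc e₄.symm, Ar.reassoc e₅, Ar.reassoc e₆]
  simp [Q]

lemma uR_al : W.uR ⬝ (W.al ⊡ ⟪D.co D.uJ W.A⟫) = W.al ⬝ (⟪W.A⟫ ⊡ W.uR) := by
  have e₁ := congrArg (⟪D.co W.A W.A⟫ ⊡ ·) (W.Q_nat W.am ⟪D.uJ⟫)
  have e₂ := congrArg (⟪D.co W.A W.A⟫ ⊡ ·) (congrArg (· ⊡ ⟪D.co D.uJ W.A⟫) W.am_assoc)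
  have e₃ := D.abu_right_left W.am (W.am ⊡ ⟪D.co D.uJ W.A⟫)
  have e₄ := (D.abu_left_right W.am W.uR).symm.trans (D.abu_right_left _ _)
  have e₅ := Ar.comp_right (⟪W.A⟫ ⊡ W.uR) W.al_Q
  have e₆ := D.abu_right_left W.am W.am
  simp [uR] at e₁ e₂ e₃ e₄ e₅ e₆
  refine W.uR_al_eq_lru.trans ?_
  simp only [← e₅, e₆, Ar.reassoc₃ W.lru_Z, Duo.one_abu_comp, Ar.comp_assoc, e₃,
    Ar.reassoc e₂.symm, e₄, Ar.reassoc e₁, uR]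

lemma uL_al_eq_rru : W.uL ⬝ (⟪D.co D.uJ W.A⟫ ⊡ W.al)
    = W.al ⬝ (⟪D.bu W.A W.A⟫ ⊚ (W.ah ⬝ (⟪W.A⟫ ⊡ W.al))) ⬝ D.Z W.A W.A (D.bu W.A W.A) W.A
      ⬝ (D.Z D.uJ W.A W.A W.A ⊡ ⟪D.co W.A W.A⟫) ⬝ (⟪D.co D.uJ W.A⟫ ⊡ W.am ⊡ W.am) := by
  have e₁ := D.Z_nat ⟪D.uJ⟫ W.al ⟪W.A⟫ W.al
  have e₂ := Ar.comp_right (⟪D.co D.uJ W.A⟫ ⊡ W.am ⊡ W.am) (D.Z_coassoc D.uJ W.A W.A W.A W.A W.A)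
  have e₃ := congrArg (⟪D.co D.uJ W.A⟫ ⊡ ·) W.am_al
  have e₄ := D.aco_left_right W.al (⟪W.A⟫ ⊡ W.al)
  have e₅ := (D.aco_left_right W.al W.ah).symm.trans (D.aco_right_left _ _)
  simp at e₁ e₂ e₃ e₄ e₅
  simp only [uL, Q, D.buL, Ar.comp_assoc, e₃, Ar.reassoc e₁.symm, ← e₂, e₄, Ar.reassoc e₅.symm,
    Duo.one_aco_comp]

lemma rru_Z : (⟪D.bu W.A W.A⟫ ⊚ (W.ah ⬝ (⟪W.A⟫ ⊡ W.al))) ⬝ D.Z W.A W.A (D.bu W.A W.A) W.A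
      ⬝ (D.Z D.uJ W.A W.A W.A ⊡ ⟪D.co W.A W.A⟫)
    = W.Q W.A W.A ⬝ ((W.Q D.uJ (D.co W.A W.A) ⬝ (⟪D.co D.uJ W.A⟫ ⊡ (⟪W.A⟫ ⊚ W.am)))
        ⊡ ⟪D.co W.A W.A⟫) := by
  have e₁ := D.Z_nat ⟪W.A⟫ ⟪W.A⟫ (W.Q D.uI W.A ⬝ (⟪W.A⟫ ⊡ W.am)) ⟪W.A⟫
  have e₂ := congrArg (· ⊡ ⟪D.co W.A W.A⟫) (W.Z_Q D.uJ W.A D.uI W.A)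
  have e₃ := congrArg (· ⊡ ⟪D.co W.A W.A⟫) (D.Z_nat ⟪D.uJ⟫ ⟪W.A⟫ ⟪W.A⟫ W.am)
  have e₄ := D.Z_coassoc D.uJ W.A W.A D.uI W.A W.A
  have e₅ := D.Z_nat ⟪D.uJ⟫ ⟪D.bu W.A W.A⟫ ⟪D.uI⟫ W.ah
  have e₆ := D.ad_Z D.uJ (D.bu W.A W.A)
  simp at e₁ e₂ e₃ e₄ e₅ e₆
  simp only [W.rru', Duo.one_aco_comp, Ar.comp_assoc, Ar.reassoc₃ e₁, e₃, Ar.reassoc e₂.symm,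
    Ar.reassoc e₄, Ar.reassoc e₅, Ar.reassoc e₆]
  simp [Q]

lemma uL_al : W.uL ⬝ (⟪D.co D.uJ W.A⟫ ⊡ W.al) = W.al ⬝ (W.uL ⊡ ⟪W.A⟫) := by
  have e₁ := congrArg (· ⊡ ⟪D.co W.A W.A⟫) (W.Q_nat ⟪D.uJ⟫ W.am)
  have e₂ := congrArg (· ⊡ ⟪D.co W.A W.A⟫) (congrArg (⟪D.co D.uJ W.A⟫ ⊡ ·) W.am_assoc)
  have e₄ := (D.abu_left_right W.uL W.am).symm.trans (D.abu_right_left _ _)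
  have e₅ := Ar.comp_right (W.uL ⊡ ⟪W.A⟫) W.al_Q
  have e₆ := D.abu_left_right W.am W.am
  simp [uL] at e₁ e₂ e₄ e₅ e₆
  refine W.uL_al_eq_rru.trans ?_
  simp only [← e₅, e₆, Ar.reassoc₃ W.rru_Z, Duo.comp_abu_one, Duo.one_abu_comp,
    Duo.one_abu_one_abu, Duo.abu_assoc, Ar.comp_assoc, Ar.reassoc e₂.symm, ← e₄, Ar.reassoc e₁, uL]

/-- The arrow `τ∘A : A ⟶ J∘A`. -/
def ta : Ar M := D.atau ⊚ ⟪W.A⟫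

@[simp] lemma ta_s : W.ta.s = W.A := by simp [ta]
@[simp] lemma ta_t : W.ta.t = D.co D.uJ W.A := by simp [ta]

lemma ta_em : (W.ta ⊚ ⟪W.A⟫) ⬝ W.em = W.am ⬝ W.ae := by
  have e₁ := (D.aco_left_right D.atau W.am).symm.trans (D.aco_right_left _ _)
  have e₂ := (D.aco_left_right D.atau W.ae).symm.trans (D.aco_right_left _ _)
  simp at e₁ e₂
  simp [em, ta, Ar.reassoc e₁, Ar.reassoc e₂, D.at_aw]

lemma ta_sq : W.ta ⬝ W.sq = W.uL ⬝ (⟪D.co D.uJ W.A⟫ ⊡ W.ae) := by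
  have e₁ := W.Q_nat ⟪D.uJ⟫ W.ta
  have e₂ := congrArg (⟪D.co D.uJ W.A⟫ ⊡ ·) W.ta_em
  simp at e₁ e₂
  simp only [sq, Ar.reassoc e₁, Ar.comp_assoc, e₂, uL]

lemma ta_sqb : W.ta ⬝ W.sqb = W.uR ⬝ (W.ae ⊡ ⟪D.co D.uJ W.A⟫) := by
  have e₁ := W.Q_nat W.ta ⟪D.uJ⟫
  have e₂ := congrArg (· ⊡ ⟪D.co D.uJ W.A⟫) W.ta_em
  simp at e₁ e₂
  simp only [sqb, Ar.reassoc e₁, Ar.comp_assoc, e₂, uR]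

lemma al_ta_sq : W.al ⬝ (W.ta ⬝ W.sq) ⊡ ⟪W.A⟫ = W.uL := by
  have e₁ := congrArg (⟪D.co D.uJ W.A⟫ ⊡ ·) W.al_ae_left
  simp at e₁
  simp [ta_sq, Ar.reassoc W.uL_al.symm, e₁]

lemma al_ta_sqb : W.al ⬝ ⟪W.A⟫ ⊡ (W.ta ⬝ W.sqb) = W.uR := by
  have e₁ := congrArg (· ⊡ ⟪D.co D.uJ W.A⟫) W.al_ae_right
  simp at e₁
  simp [ta_sqb, Ar.reassoc W.uR_al.symm, e₁]

section Retract

variable {R : M} (p : W.JA ⟶ R) (i : R ⟶ W.JA)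

/-- The projection `π^R_∘` as an arrow. -/
def ap : Ar M := ⟨D.co D.uJ W.A, R, p⟩

/-- The inclusion `ι^R_∘` as an arrow. -/
def ai : Ar M := ⟨R, D.co D.uJ W.A, i⟩

@[simp] lemma ap_s : (W.ap p).s = D.co D.uJ W.A := rfl
@[simp] lemma ap_t : (W.ap p).t = R := rfl
@[simp] lemma ai_s : (W.ai i).s = R := rfl
@[simp] lemma ai_t : (W.ai i).t = D.co D.uJ W.A := rfl

/-- The left `J`-action on `R_∘` as an arrow. -/
def gJ : Ar M := (⟪D.uJ⟫ ⊚ W.ai i) ⬝ (D.aw ⊚ ⟪W.A⟫) ⬝ W.ap p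

/-- The right `A`-action on `R_∘` as an arrow. -/
def gA : Ar M := (W.ai i ⊚ ⟪W.A⟫) ⬝ W.jm ⬝ W.ap p

@[simp] lemma gJ_s : (W.gJ p i).s = D.co D.uJ R := by simp [gJ]
@[simp] lemma gJ_t : (W.gJ p i).t = R := by simp [gJ]
@[simp] lemma gA_s : (W.gA p i).s = D.co R W.A := by simp [gA]
@[simp] lemma gA_t : (W.gA p i).t = R := by simp [gA]

/-- The comultiplication of `R_∘` as an arrow. -/
def dR : Ar M := (⟪R⟫ ⊡ ((⟪D.uJ⟫ ⊚ W.an) ⬝ W.ap p)) ⬝ W.Q R R ⬝ (W.gA p i ⊡ W.gA p i)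

/-- The counit of `R_∘` as an arrow. -/
def eR : Ar M := W.ai i ⬝ W.ej

/-- The left `R_∘`-coaction on `A` as an arrow. -/
def rho : Ar M := W.al ⬝ ((W.ta ⬝ W.ap p) ⊡ ⟪W.A⟫)

@[simp] lemma dR_s : (W.dR p i).s = R := by simp [dR]
@[simp] lemma dR_t : (W.dR p i).t = D.bu R R := by simp [dR]
@[simp] lemma eR_s : (W.eR i).s = R := by simp [eR]
@[simp] lemma eR_t : (W.eR i).t = D.uJ := by simp [eR]
@[simp] lemma rho_s : (W.rho p).s = W.A := by simp [rho]
@[simp] lemma rho_t : (W.rho p).t = D.bu R W.A := by simp [rho]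

variable {p i}

lemma sq_ap (hpi : W.ap p ⬝ W.ai i = W.sq) (hip : W.ai i ⬝ W.ap p = ⟪R⟫) :
    W.sq ⬝ W.ap p = W.ap p := by
  simp [← hpi, hip]

lemma ai_sq (hpi : W.ap p ⬝ W.ai i = W.sq) (hip : W.ai i ⬝ W.ap p = ⟪R⟫) :
    W.ai i ⬝ W.sq = W.ai i := by
  simp [← hpi, Ar.reassoc hip]

lemma sqb_ap (hpi : W.ap p ⬝ W.ai i = W.sq) (hip : W.ai i ⬝ W.ap p = ⟪R⟫) :
    W.sqb ⬝ W.ap p = W.ap p := by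
  have e₁ := Ar.comp_right (W.ap p) W.sqb_sq
  simpa only [Ar.comp_assoc, W.sq_ap hpi hip] using e₁

lemma gJ_ai (hpi : W.ap p ⬝ W.ai i = W.sq) (hip : W.ai i ⬝ W.ap p = ⟪R⟫) :
    W.gJ p i ⬝ W.ai i = (⟪D.uJ⟫ ⊚ W.ai i) ⬝ (D.aw ⊚ ⟪W.A⟫) := by
  have e₁ := congrArg (⟪D.uJ⟫ ⊚ ·) (W.ai_sq hpi hip)
  simp at e₁
  simp only [gJ, Ar.comp_assoc, hpi, W.aw_sq, Ar.reassoc e₁]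

lemma aw_ap (hpi : W.ap p ⬝ W.ai i = W.sq) (hip : W.ai i ⬝ W.ap p = ⟪R⟫) :
    (D.aw ⊚ ⟪W.A⟫) ⬝ W.ap p = (⟪D.uJ⟫ ⊚ W.ap p) ⬝ W.gJ p i := by
  have e₁ := congrArg (⟪D.uJ⟫ ⊚ ·) hpi
  simp at e₁
  have e₂ := Ar.comp_right (W.ap p) W.aw_sq
  simp only [Ar.comp_assoc, W.sq_ap hpi hip] at e₂
  simp only [gJ, Ar.reassoc e₁]
  exact e₂

lemma ap_gA (hpi : W.ap p ⬝ W.ai i = W.sq) (hip : W.ai i ⬝ W.ap p = ⟪R⟫) :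
    (W.ap p ⊚ ⟪W.A⟫) ⬝ W.gA p i = W.jm ⬝ W.ap p := by
  have e₁ := congrArg (· ⊚ ⟪W.A⟫) hpi
  have e₂ := Ar.comp_right (W.ap p) W.jm_sq
  simp at e₁ e₂
  simp only [W.sq_ap hpi hip] at e₂
  simp only [gA, Ar.reassoc e₁]
  exact e₂.symm

lemma gA_gJ (hpi : W.ap p ⬝ W.ai i = W.sq) (hip : W.ai i ⬝ W.ap p = ⟪R⟫) :
    (⟪D.uJ⟫ ⊚ W.gA p i) ⬝ W.gJ p i = (W.gJ p i ⊚ ⟪W.A⟫) ⬝ W.gA p i := by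
  have e₁ := congrArg (· ⊚ ⟪W.A⟫) (W.gJ_ai hpi hip)
  have e₂ := (D.aco_left_right D.aw W.am).symm.trans (D.aco_right_left _ _)
  simp at e₁ e₂
  conv_rhs => simp only [gA]
  simp only [Ar.reassoc e₁, jm, Ar.comp_assoc, Ar.reassoc e₂, W.aw_ap hpi hip]
  simp [gA, jm]

lemma rho_eq (hpi : W.ap p ⬝ W.ai i = W.sq) (hip : W.ai i ⬝ W.ap p = ⟪R⟫) :
    W.rho p = W.uL ⬝ (W.ap p ⊡ ⟪W.A⟫) := by
  have e₁ := congrArg (· ⊡ ⟪W.A⟫) (W.sq_ap hpi hip)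
  have e₂ := Ar.comp_right (W.ap p ⊡ ⟪W.A⟫) W.al_ta_sq
  simp at e₁ e₂
  simp only [← e₂, e₁, rho, Duo.comp_abu_one]

lemma ap_dR (hpi : W.ap p ⬝ W.ai i = W.sq) (hip : W.ai i ⬝ W.ap p = ⟪R⟫) :
    W.ap p ⬝ W.dR p i = (⟪D.co D.uJ W.A⟫ ⊡ (⟪D.uJ⟫ ⊚ W.an))
      ⬝ W.Q (D.co D.uJ W.A) (D.co D.uJ W.A) ⬝ ((W.jm ⬝ W.ap p) ⊡ (W.jm ⬝ W.ap p)) := by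
  have e₁ := W.Q_nat (W.ap p) (W.ap p)
  have e₂ := D.abu_comp (W.ap p ⊚ ⟪W.A⟫) (W.gA p i) (W.ap p ⊚ ⟪W.A⟫) (W.gA p i)
    ⟨by simp⟩ ⟨by simp⟩
  simp only [W.ap_gA hpi hip] at e₂
  have e₄ := D.abu_comp (W.ap p) ⟪R⟫ ⟪D.uJ⟫ ((⟪D.uJ⟫ ⊚ W.an) ⬝ W.ap p) ⟨by simp⟩ ⟨by simp⟩
  have e₅ := D.abu_comp ⟪D.co D.uJ W.A⟫ (W.ap p) (⟪D.uJ⟫ ⊚ W.an) (W.ap p) ⟨by simp⟩ ⟨by simp⟩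
  simp at e₁ e₄ e₅
  have e₆ := e₄.symm.trans e₅
  simp only [dR, Duo.one_abu_comp, Ar.comp_assoc, e₂, Ar.reassoc e₁.symm, Ar.reassoc₃ e₆]

lemma ta_ap_dR (hpi : W.ap p ⬝ W.ai i = W.sq) (hip : W.ai i ⬝ W.ap p = ⟪R⟫) :
    W.ta ⬝ W.ap p ⬝ W.dR p i = W.al ⬝ ((W.ta ⬝ W.ap p) ⊡ (W.ta ⬝ W.ap p)) := by
  have e₁ := (D.abu_left_right W.ta (⟪D.uJ⟫ ⊚ W.an)).symm.trans (D.abu_right_left _ _)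
  have e₂ := W.Q_nat W.ta ⟪D.co D.uJ W.A⟫
  have e₃ := W.Q_nat ⟪W.A⟫ (⟪D.uJ⟫ ⊚ W.an)
  have e₄ := (D.aco_left_right D.atau W.am).symm.trans (D.aco_right_left _ _)
  have e₅ := congrArg (⟪D.uJ⟫ ⊚ ·) W.an_am
  have e₆ := D.abu_comp (W.ta ⊚ ⟪W.A⟫) (W.jm ⬝ W.ap p) ⟪D.co D.uJ (D.co W.A W.A)⟫ (W.jm ⬝ W.ap p)
    ⟨by simp⟩ ⟨by simp⟩
  have e₇ := D.abu_comp ⟪D.co W.A W.A⟫ (W.am ⬝ W.ta ⬝ W.ap p) (⟪D.uJ⟫ ⊚ W.an ⊚ ⟪W.A⟫)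
    (W.jm ⬝ W.ap p) ⟨by simp⟩ ⟨by simp⟩
  have e₈ := D.abu_comp W.am (W.ta ⬝ W.ap p) ⟪D.co D.uJ W.A⟫ (W.ap p) ⟨by simp⟩ ⟨by simp⟩
  have e₉ := D.abu_comp ⟪W.A⟫ (W.ta ⬝ W.ap p) (W.ta ⬝ W.sqb) (W.ap p) ⟨by simp⟩ ⟨by simp⟩
  have e₁₀ := Ar.comp_right ((W.ta ⬝ W.ap p) ⊡ W.ap p) W.al_ta_sqb
  simp [ta] at e₁ e₂ e₃ e₄ e₅
  simp only [ta, jm, Ar.comp_assoc, Ar.one_comp, Ar.reassoc e₄, Ar.reassoc e₅, Duo.aco_assoc,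
    Duo.one_aco_one] at e₆ e₇ e₈
  simp only [W.sqb_ap hpi hip, Ar.one_comp, Ar.comp_assoc] at e₉
  simp only [Ar.comp_assoc, e₉.symm, uR] at e₁₀
  simp only [W.ap_dR hpi hip, e₁₀]
  simp only [ta, jm, Ar.reassoc e₁, Ar.reassoc e₂, Ar.reassoc e₃, e₆.symm, e₇.symm, e₈,
    Ar.comp_assoc]

lemma gJ_eR (hpi : W.ap p ⬝ W.ai i = W.sq) (hip : W.ai i ⬝ W.ap p = ⟪R⟫) :
    W.gJ p i ⬝ W.eR i = (⟪D.uJ⟫ ⊚ W.eR i) ⬝ D.aw := by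
  have e₂ := (D.aco_left_right D.aw W.ae).symm.trans (D.aco_right_left _ _)
  simp at e₂
  simp [eR, ej, Ar.reassoc (W.gJ_ai hpi hip), Ar.reassoc e₂, D.aw_assoc]

lemma rho_eR (hpi : W.ap p ⬝ W.ai i = W.sq) :
    W.rho p ⬝ (W.eR i ⊡ ⟪W.A⟫) = ⟪W.A⟫ := by
  have e₁ := congrArg (fun x => x ⊡ ⟪W.A⟫) hpi
  have e₂ := congrArg (fun x => x ⊡ ⟪W.A⟫) W.sq_ej
  have e₃ := (D.aco_left_right D.atau W.ae).symm.trans (D.aco_right_left _ _)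
  have e₄ := congrArg (fun x => x ⊡ ⟪W.A⟫) e₃
  have e₅ := congrArg (fun x => x ⊡ ⟪W.A⟫) D.at_aw
  simp [ej] at e₁ e₂ e₄ e₅
  simp [rho, eR, ta, ej, Ar.reassoc e₁, e₂, Ar.reassoc e₄, e₅, W.al_ae_left]

lemma rho_dR (hpi : W.ap p ⬝ W.ai i = W.sq) (hip : W.ai i ⬝ W.ap p = ⟪R⟫) :
    W.rho p ⬝ (W.dR p i ⊡ ⟪W.A⟫) = W.rho p ⬝ (⟪R⟫ ⊡ W.rho p) := by
  have e₁ := congrArg (· ⊡ ⟪W.A⟫) (W.ta_ap_dR hpi hip)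
  have e₂ := (D.abu_left_right (W.ta ⬝ W.ap p) W.al).symm.trans (D.abu_right_left _ _)
  have e₃ := D.abu_left_right (W.ta ⬝ W.ap p) ((W.ta ⬝ W.ap p) ⊡ ⟪W.A⟫)
  simp at e₁ e₂ e₃
  simp only [rho, Duo.comp_abu_one, Duo.one_abu_comp, Ar.comp_assoc, e₁, e₃, Ar.reassoc₃ e₂,
    Ar.reassoc W.al_coassoc]

lemma gJ_dR (hpi : W.ap p ⬝ W.ai i = W.sq) (hip : W.ai i ⬝ W.ap p = ⟪R⟫) :
    W.gJ p i ⬝ W.dR p i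
      = (⟪D.uJ⟫ ⊚ W.dR p i) ⬝ D.Z D.uJ D.uJ R R ⬝ (W.gJ p i ⊡ W.gJ p i) := by
  have e₁ := D.Z_nat ⟪D.uJ⟫ ⟪D.uJ⟫ (W.gA p i) (W.gA p i)
  have e₂ := D.abu_comp (⟪D.uJ⟫ ⊚ W.gA p i) (W.gJ p i) (⟪D.uJ⟫ ⊚ W.gA p i) (W.gJ p i)
    ⟨by simp⟩ ⟨by simp⟩
  have e₃ := D.abu_comp (W.gJ p i ⊚ ⟪W.A⟫) (W.gA p i) (W.gJ p i ⊚ ⟪W.A⟫) (W.gA p i)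
    ⟨by simp⟩ ⟨by simp⟩
  simp only [W.gA_gJ hpi hip] at e₂
  have e₄ := W.Z_Q D.uJ D.uJ R R
  have e₅ := W.Q_nat (W.gJ p i) (W.gJ p i)
  have e₆ := D.Z_nat ⟪D.uJ⟫ ⟪D.uJ⟫ ⟪R⟫ ((⟪D.uJ⟫ ⊚ W.an) ⬝ W.ap p)
  have e₇ : (⟪D.uJ⟫ ⊚ ((⟪D.uJ⟫ ⊚ W.an) ⬝ W.ap p)) ⬝ W.gJ p i
      = D.aw ⬝ (⟪D.uJ⟫ ⊚ W.an) ⬝ W.ap p := by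
    have e := (D.aco_left_right D.aw W.an).symm.trans (D.aco_right_left _ _)
    simp at e
    simp only [Duo.one_aco_comp, Ar.comp_assoc, ← W.aw_ap hpi hip, Duo.one_aco_one_aco,
      Ar.reassoc e.symm]
  have e₈ := D.abu_comp ⟪D.co D.uJ R⟫ (W.gJ p i) (⟪D.uJ⟫ ⊚ ((⟪D.uJ⟫ ⊚ W.an) ⬝ W.ap p))
    (W.gJ p i) ⟨by simp⟩ ⟨by simp⟩
  have e₉ := D.abu_right_left (W.gJ p i) (D.aw ⬝ (⟪D.uJ⟫ ⊚ W.an) ⬝ W.ap p)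
  have e₁₀ := (D.abu_left_right (W.gJ p i) ((⟪D.uJ⟫ ⊚ W.an) ⬝ W.ap p)).symm.trans
    (D.abu_right_left _ _)
  have e₁₁ := D.Z_aw_right D.uJ R
  simp only [e₇] at e₈
  simp at e₁ e₄ e₅ e₆ e₈ e₉ e₁₀ e₁₁
  have e₁₂ := e₂.symm.trans e₃
  have e₁₃ := e₈.symm.trans e₉
  simp only [dR, Duo.one_abu_comp, Duo.one_aco_comp, Ar.comp_assoc, Ar.reassoc e₁, e₁₂,
    Ar.reassoc e₄.symm, Ar.reassoc e₅.symm, Ar.reassoc₃ e₆, Ar.reassoc₃ e₁₃, Ar.reassoc e₁₁,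
    Ar.reassoc₃ e₁₀, Ar.one_comp]

variable (p i) in
/-- The left `R_∘`-coaction on `A∘A` as an arrow. -/
def rhoTwo : Ar M :=
  (⟪W.A⟫ ⊚ W.rho p) ⬝ D.Z D.uJ W.A R W.A ⬝ (W.gJ p i ⊡ ⟪D.co W.A W.A⟫)

@[simp] lemma rhoTwo_s : (W.rhoTwo p i).s = D.co W.A W.A := by simp [rhoTwo]
@[simp] lemma rhoTwo_t : (W.rhoTwo p i).t = D.bu R (D.co W.A W.A) := by simp [rhoTwo]

lemma rhoTwo_eR (hpi : W.ap p ⬝ W.ai i = W.sq) (hip : W.ai i ⬝ W.ap p = ⟪R⟫) :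
    W.rhoTwo p i ⬝ (W.eR i ⊡ ⟪D.co W.A W.A⟫) = ⟪D.co W.A W.A⟫ := by
  have e₁ := congrArg (· ⊡ ⟪D.co W.A W.A⟫) (W.gJ_eR hpi hip)
  have e₂ := D.Z_nat ⟪D.uJ⟫ ⟪W.A⟫ (W.eR i) ⟪W.A⟫
  have e₃ := congrArg (⟪W.A⟫ ⊚ ·) (W.rho_eR hpi)
  have e₄ := D.Z_aw_left W.A W.A
  simp at e₁ e₂ e₃ e₄
  simp only [rhoTwo, Ar.comp_assoc, e₁, Ar.reassoc e₂.symm, Ar.reassoc e₃, Ar.one_comp, e₄]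

lemma rhoTwo_dR (hpi : W.ap p ⬝ W.ai i = W.sq) (hip : W.ai i ⬝ W.ap p = ⟪R⟫) :
    W.rhoTwo p i ⬝ (W.dR p i ⊡ ⟪D.co W.A W.A⟫) = W.rhoTwo p i ⬝ (⟪R⟫ ⊡ W.rhoTwo p i) := by
  have e₁ := congrArg (· ⊡ ⟪D.co W.A W.A⟫) (W.gJ_dR hpi hip)
  have e₂ := D.Z_nat ⟪D.uJ⟫ ⟪W.A⟫ (W.dR p i) ⟪W.A⟫
  have e₃ := congrArg (⟪W.A⟫ ⊚ ·) (W.rho_dR hpi hip)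
  have e₄ := D.Z_coassoc D.uJ D.uJ W.A R R W.A
  have e₅ := D.Z_nat ⟪D.uJ⟫ ⟪W.A⟫ ⟪R⟫ (W.rho p)
  have e₆ := (D.abu_left_right (W.gJ p i) (W.rhoTwo p i)).symm.trans (D.abu_right_left _ _)
  have e₇ := D.abu_right_left (W.gJ p i) (W.gJ p i ⊡ ⟪D.co W.A W.A⟫)
  simp [rhoTwo] at e₁ e₂ e₃ e₄ e₅ e₆ e₇
  simp only [rhoTwo, Ar.comp_assoc, Duo.one_abu_comp, e₁, Ar.reassoc e₂.symm, Ar.reassoc e₃,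
    Ar.reassoc e₄, Ar.reassoc e₅, e₆, e₇]

lemma am_rho (hpi : W.ap p ⬝ W.ai i = W.sq) (hip : W.ai i ⬝ W.ap p = ⟪R⟫) :
    W.am ⬝ W.rho p = W.rhoTwo p i ⬝ (⟪R⟫ ⊡ W.am) := by
  have e₁ := W.Q_nat ⟪D.uJ⟫ W.am
  have e₂ := congrArg (⟪D.co D.uJ W.A⟫ ⊡ ·) W.am_assoc
  have e₃ := D.Z_nat ⟪D.uJ⟫ ⟪W.A⟫ (W.ap p) ⟪W.A⟫
  have e₄ := congrArg (· ⊡ ⟪D.co W.A W.A⟫) (W.aw_ap hpi hip)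
  have e₅ := D.Z_nat ⟪D.uJ⟫ ⟪W.A⟫ ⟪D.co D.uJ W.A⟫ W.am
  have e₆ := W.Z_Q D.uJ W.A D.uJ W.A
  have e₇ := (D.abu_left_right (D.aw ⊚ ⟪W.A⟫) (⟪W.A⟫ ⊚ W.am)).symm.trans (D.abu_right_left _ _)
  have e₈ := W.Q_nat D.aw ⟪D.co W.A W.A⟫
  have e₉ := D.Z_aw_left W.A W.A
  have e₁₀ := (D.abu_left_right (W.ap p) W.am).symm.trans (D.abu_right_left _ _)
  simp at e₁ e₂ e₃ e₄ e₅ e₆ e₇ e₈ e₉ e₁₀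
  simp only [rhoTwo, W.rho_eq hpi hip, uL, Ar.comp_assoc, Duo.one_aco_comp, Ar.reassoc e₁,
    Ar.reassoc e₂, Ar.reassoc e₃, Ar.reassoc e₄.symm, Ar.reassoc e₅, Ar.reassoc e₆.symm,
    Ar.reassoc e₇.symm, Ar.reassoc e₈.symm, Ar.reassoc e₉, e₁₀, Ar.one_comp]

end Retract

lemma mk_tauA : (⟨_, _, W.tauA⟩ : Ar M) = W.ta := by
  have h : W.tauA = (eqToHom (D.coL W.A).symm ≫ D.coh D.tau (𝟙 W.A) :
      W.A ⟶ D.co D.uJ W.A) := rfl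
  rw [h]
  simp only [JA, Ar.mk_comp, Duo.mk_coh, Ar.mk_eqToHom, Ar.mk_id, Ar.one_comp, Duo.mk_tau, ta]

section Retract

variable {R : M} (p : D.co D.uJ W.A ⟶ R) (i : R ⟶ D.co D.uJ W.A)

lemma mk_gamJ : (⟨_, _, W.gamJ R p i⟩ : Ar M) = W.gJ p i := by
  have h : W.gamJ R p i = (D.coh (𝟙 D.uJ) i
      ≫ eqToHom (D.coA D.uJ D.uJ W.A).symm ≫ D.coh D.pw (𝟙 W.A)
      ≫ p) := rfl
  rw [h]
  simp only [Ar.mk_comp, Duo.mk_coh, Ar.mk_eqToHom, Ar.mk_id, Ar.one_comp, Duo.mk_pw]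
  rfl

lemma mk_gamA : (⟨_, _, W.gamA R p i⟩ : Ar M) = W.gA p i := by
  have h : W.gamA R p i = (D.coh i (𝟙 W.A)
      ≫ eqToHom (D.coA D.uJ W.A W.A) ≫ D.coh (𝟙 D.uJ) W.mu
      ≫ p) := rfl
  rw [h]
  simp only [Ar.mk_comp, Duo.mk_coh, Ar.mk_eqToHom, Ar.mk_id, Ar.one_comp, mk_mu]
  rfl

lemma mk_epsR : (⟨_, _, W.epsR R i⟩ : Ar M) = W.eR i := by
  have h : W.epsR R i = (i ≫ D.coh (𝟙 D.uJ) W.ep ≫ D.pw) := rfl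
  rw [h]
  simp only [Ar.mk_comp, Duo.mk_coh, Ar.mk_id, Duo.mk_pw, mk_ep]
  rfl

lemma mk_DeltaR : (⟨_, _, W.DeltaR R p i⟩ : Ar M) = W.dR p i := by
  have h : W.DeltaR R p i = (eqToHom (D.buR R).symm
      ≫ D.buh (𝟙 R) (eqToHom (D.coR D.uJ).symm ≫ D.coh (𝟙 D.uJ) W.eta :
          D.uJ ⟶ D.co D.uJ W.A)
      ≫ D.buh (𝟙 R) p
      ≫ eqToHom (by simp)
      ≫ D.coh (𝟙 (D.bu R R)) (W.eta ≫ W.dl)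
      ≫ D.zt R R W.A W.A
      ≫ D.buh (W.gamA R p i) (W.gamA R p i)) := rfl
  rw [h]
  simp only [Ar.mk_comp, Duo.mk_coh, Duo.mk_buh, Ar.mk_eqToHom, Ar.mk_id, Ar.one_comp,
    mk_eta, mk_dl, Duo.mk_zt, mk_gamA, dR, Q, ah, Duo.one_abu_comp, Ar.comp_assoc]
  rfl

end Retract

end RWB

/-- **Statement 11.**  Let `A` be a right weak bimonoid in a duoidal category with
split idempotents, with a fixed splitting of `⊓^R_∘` through `R_∘`.  With the left
`R_∘`-coaction `ρ := (π^R_∘•A).((τ∘A)•A).Δ` on `A` and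
`ρ₂ := (γ_J•(A∘A)).ζ.(A∘ρ)` on `A∘A`, the morphism `ρ₂` is a coassociative counital
left `R_∘`-coaction and `μ : A∘A ⟶ A` is a morphism of left `R_∘`-comodules. -/
theorem mu_is_left_R_comodule_morphism
    {M : Type u} [Category.{v} M] (D : Duo M) (W : RWB D)
    (hsplit : SplitIdem M)
    (R : M) (p : W.JA ⟶ R) (i : R ⟶ W.JA)
    (hpi : p ≫ i = W.sqcapR) (hip : i ≫ p = 𝟙 R) :
    -- the coactions
    let rho : W.A ⟶ D.bu R W.A := W.dl ≫ D.buh (W.tauA ≫ p) (𝟙 W.A)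
    let rho2 : D.co W.A W.A ⟶ D.bu R (D.co W.A W.A) :=
      D.coh (𝟙 W.A) rho
        ≫ eqToHom (show D.co W.A (D.bu R W.A)
            = D.co (D.bu D.uJ W.A) (D.bu R W.A) by simp [D.buL])
        ≫ D.zt D.uJ W.A R W.A
        ≫ D.buh (W.gamJ R p i) (𝟙 (D.co W.A W.A))
    -- ρ₂ is counital …
    (rho2 ≫ D.buh (W.epsR R i) (𝟙 (D.co W.A W.A))
        ≫ eqToHom (D.buL (D.co W.A W.A)) = 𝟙 (D.co W.A W.A)) ∧
    -- … and coassociative …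
    (rho2 ≫ D.buh (W.DeltaR R p i) (𝟙 (D.co W.A W.A))
        ≫ eqToHom (D.buA R R (D.co W.A W.A))
      = rho2 ≫ D.buh (𝟙 R) rho2) ∧
    -- … and μ is a morphism of left R_∘-comodules:  ρ.μ = (R_∘•μ).ρ₂
    (W.mu ≫ rho = rho2 ≫ D.buh (𝟙 R) W.mu) := by
  intro rho rho2
  have hpi' : (W.ap p).comp (W.ai i) = W.sq := by
    rw [← W.mk_sqcapR, ← hpi, Ar.mk_comp]
    rfl
  have hip' : (W.ai i).comp (W.ap p) = Ar.one R := by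
    rw [← Ar.mk_id, ← hip, Ar.mk_comp]
    rfl
  have h₁ : (⟨_, _, rho⟩ : Ar M) = W.rho p := by
    simp only [rho, Ar.mk_comp, Duo.mk_buh, Ar.mk_id, RWB.mk_dl, W.mk_tauA]
    rfl
  have h₂ : (⟨_, _, rho2⟩ : Ar M) = W.rhoTwo p i := by
    simp only [rho2, Ar.mk_comp, Duo.mk_coh, Duo.mk_buh, Ar.mk_id, Ar.mk_eqToHom, Duo.mk_zt,
      W.mk_gamJ p i, h₁, Ar.one_comp]
    rfl
  refine ⟨?_, ?_, ?_⟩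
  · rw [← Ar.mk_inj]
    simp only [Ar.mk_comp, Duo.mk_buh, Ar.mk_id, Ar.mk_eqToHom, W.mk_epsR i, h₂, Ar.comp_one]
    exact W.rhoTwo_eR hpi' hip'
  · rw [← Ar.mk_inj]
    simp only [Ar.mk_comp, Duo.mk_buh, Ar.mk_id, Ar.mk_eqToHom, W.mk_DeltaR p i, h₂, Ar.comp_one]
    exact W.rhoTwo_dR hpi' hip'
  · rw [← Ar.mk_inj]
    simp only [Ar.mk_comp, Duo.mk_buh, Ar.mk_id, RWB.mk_mu, h₁, h₂]
    exact W.am_rho hpi' hip'
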